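/- arXiv:2012.04370 — 3 statements merged into one kernel-verified Lean document; each statement's English description precedes it below -/
import Mathlib

section
/- Let K ⊂ ℝ^d be a compact, convex, symmetric set with Lebesgue measure 1, and let X_K, X'_K, X''_K be i.i.d. uniform on K. Then for any a ∈ ℝ^d, P(a + X_K + X'_K ∈ K) ≤ P(X_B + X'_B ∈ B), where B is the Euclidean ball of ℝ^d centered at the origin with Lebesgue measure 1 and X_B, X'_B are i.i.d. uniform on B. -/
open MeasureTheory ProbabilityTheory

set_option linter.unusedSectionVars false
set_option linter.unusedVariables false

namespace Rz
open Set
open scoped ENNReal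

/-! ### One dimension -/

lemma lt_volume_iff {S : Set ℝ} (hS : S.OrdConnected) {c : ℝ} (hc : 0 ≤ c) :
    ENNReal.ofReal c < volume S ↔ ∃ p ∈ S, ∃ q ∈ S, c < q - p := by
  constructor
  · intro h
    by_contra! H
    refine absurd h (not_lt.2 ((Real.volume_le_diam S).trans ?_))
    refine Metric.ediam_le fun x hx y hy => ?_
    rw [edist_dist, Real.dist_eq]
    refine ENNReal.ofReal_le_ofReal (abs_le.2 ⟨?_, H y hy x hx⟩)
    linarith [H x hx y hy]
  · rintro ⟨p, hp, q, hq, h⟩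
    calc ENNReal.ofReal c < ENNReal.ofReal (q - p) :=
          (ENNReal.ofReal_lt_ofReal_iff (by linarith)).2 h
      _ = volume (Icc p q) := by rw [Real.volume_Icc]
      _ ≤ volume S := measure_mono (hS.out hp hq)

lemma exists_Ioo {S : Set ℝ} (hS : S.OrdConnected) (hb : Bornology.IsBounded S) :
    ∃ c h : ℝ, 0 ≤ h ∧ S =ᵐ[volume] Ioo (c - h) (c + h) ∧ (volume S).toReal / 2 = h := by
  rcases S.eq_empty_or_nonempty with rfl | hne
  · exact ⟨0, 0, le_rfl, by simp, by simp⟩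
  · have ha := hb.bddAbove
    have hbb := hb.bddBelow
    have hle : sInf S ≤ sSup S := csInf_le_csSup hne hbb ha
    have h1 : Ioo (sInf S) (sSup S) ⊆ S := by
      intro x hx
      obtain ⟨p, hp, hpx⟩ := exists_lt_of_csInf_lt hne hx.1
      obtain ⟨q, hq, hqx⟩ := exists_lt_of_lt_csSup hne hx.2
      exact hS.out hp hq ⟨hpx.le, hqx.le⟩
    have h2 : S ⊆ Icc (sInf S) (sSup S) := fun x hx => ⟨csInf_le hbb hx, le_csSup ha hx⟩
    have h3 : S =ᵐ[volume] Ioo (sInf S) (sSup S) := by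
      refine Filter.EventuallyLE.antisymm ?_ (LE.le.eventuallyLE h1)
      exact (LE.le.eventuallyLE h2).trans Ioo_ae_eq_Icc.symm.le
    refine ⟨(sInf S + sSup S) / 2, (sSup S - sInf S) / 2, by linarith, ?_, ?_⟩
    · convert h3 using 2; ring_nf
    · rw [measure_congr h3, Real.volume_Ioo, ENNReal.toReal_ofReal (by linarith)]

lemma bathtub {α : Type*} [MeasurableSpace α] {μ : Measure α} {J J0 : Set α}
    (hJ : MeasurableSet J) (hJ0 : MeasurableSet J0)
    (hJJ : μ J = μ J0) (hfin : μ J ≠ ∞) (f : α → ℝ≥0∞) (m : ℝ≥0∞)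
    (h1 : ∀ x ∈ J0, m ≤ f x) (h2 : ∀ x, x ∉ J0 → f x ≤ m) :
    ∫⁻ x in J, f x ∂μ ≤ ∫⁻ x in J0, f x ∂μ := by
  have e : μ (J \ J0) = μ (J0 \ J) := by
    have a := measure_inter_add_sdiff (μ := μ) J hJ0
    have b := measure_inter_add_sdiff (μ := μ) J0 hJ
    rw [inter_comm, ← hJJ] at b
    have hne : μ (J ∩ J0) ≠ ∞ := ne_top_of_le_ne_top hfin (measure_mono inter_subset_left)
    exact (ENNReal.add_right_inj hne).1 (a.trans b.symm)
  rw [← lintegral_inter_add_sdiff f J hJ0, ← lintegral_inter_add_sdiff f J0 hJ, inter_comm J0 J]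
  gcongr 1
  calc ∫⁻ x in J \ J0, f x ∂μ ≤ ∫⁻ x in J \ J0, m ∂μ :=
        setLIntegral_mono' (hJ.diff hJ0) fun x hx => h2 x hx.2
    _ = ∫⁻ x in J0 \ J, m ∂μ := by simp [e]
    _ ≤ _ := setLIntegral_mono' (hJ0.diff hJ) fun x hx => h1 x hx.1

/-- overlap of two centered intervals -/
noncomputable def ov (b c u : ℝ) : ℝ≥0∞ := volume (Ioo (-b) b ∩ Ioo (u - c) (u + c))

lemma ov_anti (b c : ℝ) {u v : ℝ} (h : |u| ≤ |v|) : ov b c v ≤ ov b c u := by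
  unfold ov
  rw [Ioo_inter_Ioo, Ioo_inter_Ioo, Real.volume_Ioo, Real.volume_Ioo]
  apply ENNReal.ofReal_le_ofReal_iff'.2
  simp only [max_def, min_def]
  rcases abs_cases u with ⟨hu, _⟩ | ⟨hu, _⟩ <;> rcases abs_cases v with ⟨hv, _⟩ | ⟨hv, _⟩ <;>
    rw [hu, hv] at h <;> split_ifs <;>
    first
      | (left; linarith)

/-- the one dimensional functional -/
noncomputable def T1 (I J K : Set ℝ) (a : ℝ) : ℝ≥0∞ :=
  (volume.prod volume) {p : ℝ × ℝ | p.1 ∈ I ∧ p.2 ∈ J ∧ a + p.1 + p.2 ∈ K}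

lemma T1_eq {I J K : Set ℝ} (hI : MeasurableSet I) (hJ : MeasurableSet J) (hK : MeasurableSet K)
    (a : ℝ) : T1 I J K a = ∫⁻ s in I, volume (J ∩ (fun t => a + s + t) ⁻¹' K) := by
  unfold T1
  rw [Measure.prod_apply, ← lintegral_indicator hI]
  · congr 1
    ext s
    by_cases hs : s ∈ I
    · simp only [hs, indicator_of_mem, preimage_ofPred_eq, true_and]; rfl
    · simp [hs]
  · exact (measurable_fst hI).inter ((measurable_snd hJ).inter
      ((by fun_prop : Measurable fun p : ℝ × ℝ => a + p.1 + p.2) hK))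

lemma T1_le {I J K : Set ℝ} (hI : MeasurableSet I) (hJ : MeasurableSet J) (hK : MeasurableSet K)
    (hI' : I.OrdConnected) (hJ' : J.OrdConnected) (hK' : K.OrdConnected)
    (bI : Bornology.IsBounded I) (bJ : Bornology.IsBounded J) (bK : Bornology.IsBounded K)
    (a : ℝ) {h1 h2 h3 : ℝ} (e1 : (volume I).toReal / 2 = h1) (e2 : (volume J).toReal / 2 = h2)
    (e3 : (volume K).toReal / 2 = h3) :
    T1 I J K a ≤ T1 (Ioo (-h1) h1) (Ioo (-h2) h2) (Ioo (-h3) h3) 0 := by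
  obtain ⟨cJ, hJ1, -, eJ, e2'⟩ := exists_Ioo hJ' bJ
  obtain ⟨cK, hK1, -, eK, e3'⟩ := exists_Ioo hK' bK
  obtain rfl : hJ1 = h2 := e2'.symm.trans e2
  obtain rfl : hK1 = h3 := e3'.symm.trans e3
  have fI : volume I ≠ ∞ := bI.measure_lt_top.ne
  have key : ∀ s, volume (J ∩ (fun t => a + s + t) ⁻¹' K) = ov hJ1 hK1 ((cK - cJ - a) - s) := by
    intro s
    have q : (fun t => a + s + t) ⁻¹' K =ᵐ[volume]
        (fun t => a + s + t) ⁻¹' (Ioo (cK - hK1) (cK + hK1)) :=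
      (measurePreserving_add_left volume (a + s)).quasiMeasurePreserving.preimage_ae_eq eK
    rw [measure_congr (eJ.inter q), ov, ← measure_preimage_add volume cJ]
    congr 1
    ext t
    simp only [mem_inter_iff, mem_preimage, mem_Ioo]
    constructor <;> rintro ⟨⟨_, _⟩, _, _⟩ <;> refine ⟨⟨?_, ?_⟩, ?_, ?_⟩ <;> linarith
  rw [T1_eq hI hJ hK, T1_eq measurableSet_Ioo measurableSet_Ioo measurableSet_Ioo]
  simp only [key]
  set k := cK - cJ - a
  have hp : 0 ≤ h1 := by rw [← e1]; positivity
  calc ∫⁻ s in I, ov hJ1 hK1 (k - s)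
      ≤ ∫⁻ s in Ioo (k - h1) (k + h1), ov hJ1 hK1 (k - s) := by
        refine bathtub hI measurableSet_Ioo ?_ fI _ (ov hJ1 hK1 h1) ?_ ?_
        · rw [Real.volume_Ioo, ← ENNReal.ofReal_toReal fI]
          congr 1; linarith
        · intro x hx
          apply ov_anti
          rw [abs_of_nonneg hp, abs_le]
          constructor <;> linarith [hx.1, hx.2]
        · intro x hx
          apply ov_anti
          rw [abs_of_nonneg hp]
          by_contra! H
          rw [abs_lt] at H
          exact hx ⟨by linarith, by linarith⟩
    _ = ∫⁻ s in Ioo (-h1) h1, ov hJ1 hK1 (0 - s) := by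
        rw [← lintegral_indicator measurableSet_Ioo, ← lintegral_indicator measurableSet_Ioo,
          ← lintegral_add_left_eq_self _ k]
        congr 1
        ext s
        have e : k + s ∈ Ioo (k - h1) (k + h1) ↔ s ∈ Ioo (-h1) h1 := by
          simp only [mem_Ioo]
          constructor <;> rintro ⟨_, _⟩ <;> constructor <;> linarith
        have e' : k - (k + s) = 0 - s := by ring
        simp only [indicator, e, e']
    _ = _ := by
        congr 1
        ext s
        rw [ov]
        congr 1
        ext t
        simp only [mem_inter_iff, mem_preimage, mem_Ioo]
        constructor <;> rintro ⟨⟨_, _⟩, _, _⟩ <;> refine ⟨⟨?_, ?_⟩, ?_, ?_⟩ <;> linarith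

/-! ### Steiner symmetrization in a product `ℝ × F` -/

/-- the triple overlap functional -/
noncomputable def Phi {G : Type*} [Add G] [MeasureSpace G] (L : Set G) (a : G) : ℝ≥0∞ :=
  (volume.prod volume) {p : G × G | p.1 ∈ L ∧ p.2 ∈ L ∧ a + p.1 + p.2 ∈ L}

section Steiner
variable {F : Type*} [NormedAddCommGroup F] [InnerProductSpace ℝ F] [FiniteDimensional ℝ F]
  [MeasurableSpace F] [BorelSpace F]

/-- slice -/
def sl (L : Set (ℝ × F)) (y : F) : Set ℝ := {t | (t, y) ∈ L}

/-- Steiner symmetrization -/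
def St (L : Set (ℝ × F)) : Set (ℝ × F) :=
  {z | ∃ p q : ℝ, (p, z.2) ∈ L ∧ (q, z.2) ∈ L ∧ 2 * |z.1| < q - p}

/-- good sets -/
structure Good {G : Type*} [NormedAddCommGroup G] [NormedSpace ℝ G] [MeasurableSpace G]
    (L : Set G) : Prop where
  meas : MeasurableSet L
  conv : Convex ℝ L
  bdd : Bornology.IsBounded L

lemma sl_meas {L : Set (ℝ × F)} (h : MeasurableSet L) (y : F) : MeasurableSet (sl L y) :=
  (by fun_prop : Measurable fun t : ℝ => (t, y)) h

lemma sl_conv {L : Set (ℝ × F)} (h : Convex ℝ L) (y : F) : (sl L y).OrdConnected := by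
  apply Convex.ordConnected
  intro p hp q hq s t hs ht hst
  have := h hp hq hs ht hst
  simpa [sl, ← add_smul, hst] using this

lemma sl_bdd {L : Set (ℝ × F)} (h : Bornology.IsBounded L) (y : F) :
    Bornology.IsBounded (sl L y) := by
  obtain ⟨C, hC⟩ := h.exists_norm_le
  refine (isBounded_iff_forall_norm_le).2 ⟨C, fun t ht => ?_⟩
  exact (norm_fst_le (t, y)).trans (hC _ ht)

lemma vol_eq {L : Set (ℝ × F)} (h : MeasurableSet L) :
    volume L = ∫⁻ y, volume (sl L y) := by
  rw [Measure.volume_eq_prod, Measure.prod_apply_symm h]; rfl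

lemma mem_St {L : Set (ℝ × F)} (h : Good L) (z : ℝ × F) :
    z ∈ St L ↔ ENNReal.ofReal (2 * |z.1|) < volume (sl L z.2) := by
  rw [lt_volume_iff (sl_conv h.conv _) (by positivity)]
  constructor
  · rintro ⟨p, q, hp, hq, h⟩; exact ⟨p, hp, q, hq, h⟩
  · rintro ⟨p, hp, q, hq, h⟩; exact ⟨p, q, hp, hq, h⟩

lemma sl_St {L : Set (ℝ × F)} (h : Good L) (y : F) :
    sl (St L) y = Ioo (-((volume (sl L y)).toReal / 2)) ((volume (sl L y)).toReal / 2) := by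
  ext t
  change (t, y) ∈ St L ↔ _
  rw [mem_St h, ENNReal.ofReal_lt_iff_lt_toReal (by positivity)
    (sl_bdd h.bdd y).measure_lt_top.ne, mem_Ioo, ← abs_lt]
  simp only
  constructor <;> intro h <;> linarith

lemma St_meas {L : Set (ℝ × F)} (h : Good L) : MeasurableSet (St L) := by
  have : St L = {z : ℝ × F | ENNReal.ofReal (2 * |z.1|) < volume (sl L z.2)} := by
    ext z; exact mem_St h z
  rw [this]
  have m : Measurable fun y : F => volume (sl L y) := measurable_measure_prodMk_right h.meas
  exact measurableSet_lt (by fun_prop) (m.comp measurable_snd)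

lemma St_conv {L : Set (ℝ × F)} (h : Convex ℝ L) : Convex ℝ (St L) := by
  rintro ⟨t, y⟩ ⟨p, q, hp, hq, hpq⟩ ⟨t', y'⟩ ⟨p', q', hp', hq', hpq'⟩ a b ha hb hab
  refine ⟨a * p + b * p', a * q + b * q', by simpa using h hp hp' ha hb hab,
    by simpa using h hq hq' ha hb hab, ?_⟩
  simp only [Prod.smul_mk, Prod.mk_add_mk, smul_eq_mul] at *
  have h1 : |a * t + b * t'| ≤ a * |t| + b * |t'| := by
    refine (abs_add_le _ _).trans ?_
    rw [abs_mul, abs_mul, abs_of_nonneg ha, abs_of_nonneg hb]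
  rcases ha.eq_or_lt with rfl | ha'
  · obtain rfl : b = 1 := by linarith
    simp at *; linarith
  · nlinarith [mul_lt_mul_of_pos_left hpq ha', mul_le_mul_of_nonneg_left hpq'.le hb]

lemma vol_sl_St {L : Set (ℝ × F)} (h : Good L) (y : F) :
    volume (sl (St L) y) = volume (sl L y) := by
  rw [sl_St h, Real.volume_Ioo, ← ENNReal.ofReal_toReal (sl_bdd h.bdd y).measure_lt_top.ne]
  simp

lemma vol_St {L : Set (ℝ × F)} (h : Good L) : volume (St L) = volume L := by
  rw [vol_eq (St_meas h), vol_eq h.meas]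
  simp [vol_sl_St h]

/-- Euclidean ball of `ℝ × F` -/
def Bl (F : Type*) [NormedAddCommGroup F] (r : ℝ) : Set (ℝ × F) :=
  {z | z.1 ^ 2 + ‖z.2‖ ^ 2 < r ^ 2}

lemma St_sub {L : Set (ℝ × F)} {R : ℝ} (h : L ⊆ Bl F R) : St L ⊆ Bl F R := by
  rintro ⟨t, y⟩ ⟨p, q, hp, hq, hpq⟩
  have h1 := h hp
  have h2 := h hq
  simp only [Bl, mem_ofPred_eq] at *
  have : (2 * |t|) ^ 2 < (q - p) ^ 2 := by
    apply pow_lt_pow_left₀ hpq (by positivity) (by norm_num)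
  rw [mul_pow, sq_abs] at this
  nlinarith [sq_nonneg (p + q)]

lemma St_Bl (r : ℝ) : St (Bl F r) = Bl F r := by
  refine (St_sub le_rfl).antisymm ?_
  rintro ⟨t, y⟩ h
  simp only [Bl, mem_ofPred_eq, St] at *
  have h0 : 0 ≤ (t ^ 2 + (r ^ 2 - ‖y‖ ^ 2)) / 2 := by nlinarith [sq_nonneg t]
  set u := √((t ^ 2 + (r ^ 2 - ‖y‖ ^ 2)) / 2)
  have hu : u ^ 2 = (t ^ 2 + (r ^ 2 - ‖y‖ ^ 2)) / 2 := Real.sq_sqrt h0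
  have hu0 : 0 ≤ u := Real.sqrt_nonneg _
  refine ⟨-u, u, by linarith [neg_sq u], by linarith, ?_⟩
  have : |t| < u := by
    apply abs_lt_of_sq_lt_sq _ hu0
    linarith
  linarith

lemma Phi_eq {L : Set (ℝ × F)} (h : MeasurableSet L) (a : ℝ × F) :
    Phi L a = ∫⁻ y : F, ∫⁻ y' : F, T1 (sl L y) (sl L y') (sl L (a.2 + y + y')) a.1 := by
  unfold Phi
  set S : Set ((ℝ × F) × (ℝ × F)) := {p | p.1 ∈ L ∧ p.2 ∈ L ∧ a + p.1 + p.2 ∈ L} with hS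
  have mS : MeasurableSet S := (measurable_fst h).inter ((measurable_snd h).inter
      ((by fun_prop : Measurable fun p : (ℝ × F) × (ℝ × F) => a + p.1 + p.2) h))
  set f : (ℝ × F) × (ℝ × F) → ℝ≥0∞ := S.indicator 1
  have mf : Measurable f := measurable_one.indicator mS
  rw [← lintegral_indicator_one mS, lintegral_prod _ mf.aemeasurable, Measure.volume_eq_prod,
    lintegral_prod_symm _ (by exact (mf.lintegral_prod_right').aemeasurable)]
  congr 1
  ext y
  have : ∀ s : ℝ, ∫⁻ z : ℝ × F, f ((s, y), z) ∂(volume.prod volume)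
      = ∫⁻ y' : F, ∫⁻ t : ℝ, f ((s, y), (t, y')) := fun s => by
    rw [lintegral_prod_symm _ (by fun_prop)]
  change ∫⁻ s : ℝ, ∫⁻ z : ℝ × F, f ((s, y), z) ∂(volume.prod volume) = _
  simp only [this]
  rw [lintegral_lintegral_swap]
  · congr 1
    ext y'
    unfold T1
    have m2 : MeasurableSet
        {p : ℝ × ℝ | p.1 ∈ sl L y ∧ p.2 ∈ sl L y' ∧ a.1 + p.1 + p.2 ∈ sl L (a.2 + y + y')} :=
      (measurable_fst (sl_meas h y)).inter ((measurable_snd (sl_meas h y')).inter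
      ((by fun_prop : Measurable fun p : ℝ × ℝ => a.1 + p.1 + p.2) (sl_meas h _)))
    rw [← lintegral_indicator_one m2, lintegral_prod _ (measurable_one.indicator m2).aemeasurable]
    rfl
  · have : Measurable fun q : (ℝ × F) × ℝ => f ((q.1.1, y), (q.2, q.1.2)) := by fun_prop
    exact (this.lintegral_prod_right').aemeasurable

lemma Good.St {L : Set (ℝ × F)} (h : Good L) {R : ℝ} (hR : L ⊆ Bl F R) : Good (St L) := by
  refine ⟨St_meas h, St_conv h.conv, ?_⟩
  refine (Metric.isBounded_closedBall (x := (0 : ℝ × F)) (r := |R|)).subset ((St_sub hR).trans ?_)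
  rintro ⟨t, y⟩ hz
  simp only [Bl, mem_ofPred_eq] at hz
  rw [mem_closedBall_zero_iff, Prod.norm_mk]
  refine max_le ?_ ?_
  · apply sq_le_sq.1
    nlinarith [sq_nonneg ‖y‖]
  · rw [← abs_norm]
    apply sq_le_sq.1
    nlinarith [sq_nonneg t]

lemma Phi_le {L : Set (ℝ × F)} (h : Good L) (a : ℝ × F) :
    Phi L a ≤ Phi (St L) (0, a.2) := by
  rw [Phi_eq h.meas, Phi_eq (St_meas h)]
  refine lintegral_mono fun y => lintegral_mono fun y' => ?_
  simp only [sl_St h]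
  exact T1_le (sl_meas h.meas _) (sl_meas h.meas _) (sl_meas h.meas _) (sl_conv h.conv _)
    (sl_conv h.conv _) (sl_conv h.conv _) (sl_bdd h.bdd _) (sl_bdd h.bdd _) (sl_bdd h.bdd _)
    a.1 rfl rfl rfl

lemma mul_le_aux {p q M : ℝ≥0∞} (hp : p ≤ M) (hq : q ≤ M) : p * q ≤ M * min p q := by
  rcases le_total p q with h | h
  · rw [min_eq_left h, mul_comm]; gcongr
  · rw [min_eq_right h]; gcongr

lemma gain {L B : Set (ℝ × F)} (hL : Good L) (hB : Good B) (hSB : St B = B)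
    {M : ℝ≥0∞} (h1 : ∀ y, volume (sl L y) ≤ M) (h2 : ∀ y, volume (sl B y) ≤ M) :
    M * volume (L ∩ B) + ∫⁻ y, volume (sl (L \ B) y) * volume (sl (B \ L) y)
      ≤ M * volume (St L ∩ B) := by
  have m1 : Measurable fun y : F => volume (sl (L ∩ B) y) :=
    measurable_measure_prodMk_right (hL.meas.inter hB.meas)
  have m2 : Measurable fun y : F => volume (sl (St L ∩ B) y) :=
    measurable_measure_prodMk_right ((St_meas hL).inter hB.meas)
  rw [vol_eq (hL.meas.inter hB.meas), vol_eq ((St_meas hL).inter hB.meas),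
    ← lintegral_const_mul _ m1,
    ← lintegral_const_mul _ m2,
    ← lintegral_add_left (m1.const_mul M)]
  refine lintegral_mono fun y => ?_
  have e : volume (sl (St L ∩ B) y) = min (volume (sl L y)) (volume (sl B y)) := by
    have : sl (St L ∩ B) y = sl (St L) y ∩ sl (St B) y := by rw [hSB]; rfl
    rw [this, sl_St hL, sl_St hB, Ioo_inter_Ioo, Real.volume_Ioo]
    set u := volume (sl L y) with hu
    set v := volume (sl B y) with hv
    have fu : u ≠ ∞ := (sl_bdd hL.bdd y).measure_lt_top.ne
    have fv : v ≠ ∞ := (sl_bdd hB.bdd y).measure_lt_top.ne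
    rcases le_total u v with h | h
    · have := (ENNReal.toReal_le_toReal fu fv).2 h
      rw [min_eq_left h, min_eq_left (by linarith), max_eq_left (by linarith)]
      conv_rhs => rw [← ENNReal.ofReal_toReal fu]
      congr 1; ring
    · have := (ENNReal.toReal_le_toReal fv fu).2 h
      rw [min_eq_right h, min_eq_right (by linarith), max_eq_right (by linarith)]
      conv_rhs => rw [← ENNReal.ofReal_toReal fv]
      congr 1; ring
  have e1 : volume (sl L y) = volume (sl (L ∩ B) y) + volume (sl (L \ B) y) :=
    (measure_inter_add_sdiff _ (sl_meas hB.meas y)).symm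
  have e2 : volume (sl B y) = volume (sl (L ∩ B) y) + volume (sl (B \ L) y) := by
    rw [inter_comm]
    exact (measure_inter_add_sdiff _ (sl_meas hL.meas y)).symm
  simp only
  rw [e, e1, e2, min_add_add_left, mul_add]
  refine add_le_add_right ?_ _
  have s1 : sl (L \ B) y ⊆ sl L y := fun t ht => ht.1
  have s2 : sl (B \ L) y ⊆ sl B y := fun t ht => ht.1
  exact mul_le_aux ((measure_mono s1).trans (h1 y)) ((measure_mono s2).trans (h2 y))

lemma cross_eq {D D' : Set (ℝ × F)} (hD : MeasurableSet D) (hD' : MeasurableSet D') :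
    ∫⁻ y, volume (sl D y) * volume (sl D' y)
      = ∫⁻ t : ℝ, volume (D ∩ (fun z => z + (t, 0)) ⁻¹' D') := by
  have m (t : ℝ) : MeasurableSet (D ∩ (fun z : ℝ × F => z + (t, 0)) ⁻¹' D') :=
    hD.inter ((by fun_prop : Measurable fun z : ℝ × F => z + (t, 0)) hD')
  simp only [fun t => vol_eq (m t)]
  have mm : MeasurableSet {q : (ℝ × F) × ℝ | q.2 ∈ sl (D ∩ (fun z => z + (q.1.1, 0)) ⁻¹' D') q.1.2} := by
    have a1 : Measurable fun q : (ℝ × F) × ℝ => (q.2, q.1.2) := by fun_prop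
    have a2 : Measurable fun q : (ℝ × F) × ℝ => (q.2, q.1.2) + (q.1.1, (0 : F)) := by fun_prop
    exact (a1 hD).inter (a2 hD')
  rw [lintegral_lintegral_swap]
  · congr 1
    ext y
    have n1 : MeasurableSet {q : ℝ × ℝ | q.2 ∈ sl D y ∧ q.2 + q.1 ∈ sl D' y} :=
      (measurable_snd (sl_meas hD y)).inter
      ((by fun_prop : Measurable fun q : ℝ × ℝ => q.2 + q.1) (sl_meas hD' y))
    have : ∀ t : ℝ, volume (sl (D ∩ (fun z => z + (t, 0)) ⁻¹' D') y)
        = volume (Prod.mk t ⁻¹' {q : ℝ × ℝ | q.2 ∈ sl D y ∧ q.2 + q.1 ∈ sl D' y}) := by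
      intro t
      congr 1
      ext s
      simp [sl]
    simp only [this]
    rw [← Measure.prod_apply n1, Measure.prod_apply_symm n1]
    have : ∀ s : ℝ, volume ((fun t => (t, s)) ⁻¹'
        {q : ℝ × ℝ | q.2 ∈ sl D y ∧ q.2 + q.1 ∈ sl D' y})
        = (sl D y).indicator (fun _ => volume (sl D' y)) s := by
      intro s
      by_cases hs : s ∈ sl D y
      · rw [indicator_of_mem hs, ← measure_preimage_add volume s (sl D' y)]
        congr 1
        ext t
        simp [hs]
      · simp [hs]
    simp only [this]
    rw [lintegral_indicator_const (sl_meas hD y), mul_comm]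
  · exact (measurable_measure_prodMk_left mm).aemeasurable

end Steiner

/-! ### Transfer to Euclidean space -/

section Euclid
variable {n : ℕ}

/-- Euclidean space of dimension `m` -/
abbrev EE (m : ℕ) := EuclideanSpace ℝ (Fin m)

lemma exists_psi (e : EE (n + 1)) (he : ‖e‖ = 1) :
    ∃ ψ : EE (n + 1) ≃L[ℝ] ℝ × EE n, MeasurePreserving ψ volume volume ∧ ψ e = (1, 0) ∧
      ∀ x, ‖x‖ ^ 2 = (ψ x).1 ^ 2 + ‖(ψ x).2‖ ^ 2 := by
  have hf : Module.finrank ℝ (WithLp 2 (ℝ × EE n)) = n + 1 := by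
    rw [(WithLp.linearEquiv 2 ℝ (ℝ × EE n)).finrank_eq]
    simp [add_comm]
  let U0 : EE (n + 1) ≃ₗᵢ[ℝ] WithLp 2 (ℝ × EE n) :=
    ((stdOrthonormalBasis ℝ (WithLp 2 (ℝ × EE n))).reindex (finCongr hf)).repr.symm
  let w : WithLp 2 (ℝ × EE n) := WithLp.toLp 2 (1, 0)
  have hw : ‖U0 e‖ = ‖w‖ := by
    rw [U0.norm_map, he]
    have := WithLp.prod_norm_sq_eq_of_L2 w
    have h1 : ‖w‖ ^ 2 = 1 := by rw [this]; simp [w]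
    nlinarith [norm_nonneg w]
  let U := U0.trans ((ℝ ∙ (U0 e - w))ᗮ.reflection)
  refine ⟨U.toContinuousLinearEquiv.trans (WithLp.prodContinuousLinearEquiv 2 ℝ ℝ (EE n)),
    (WithLp.volume_preserving_ofLp ℝ (EE n)).comp U.measurePreserving, ?_, ?_⟩
  · have : U e = w := Submodule.reflection_sub hw
    change WithLp.ofLp (U e) = _
    rw [this]
  · intro x
    rw [← U.norm_map x, WithLp.prod_norm_sq_eq_of_L2, Real.norm_eq_abs, sq_abs]
    rfl

section
variable {G H : Type*} [NormedAddCommGroup G] [NormedSpace ℝ G] [MeasureSpace G] [BorelSpace G]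
  [NormedAddCommGroup H] [NormedSpace ℝ H] [MeasureSpace H] [BorelSpace H]
  [SecondCountableTopology H] [SFinite (volume : Measure G)] [SFinite (volume : Measure H)]

lemma Phi_transfer (ψ : G ≃L[ℝ] H) (hψ : MeasurePreserving ψ volume volume) {M : Set H}
    (hM : MeasurableSet M) (a : G) : Phi (ψ ⁻¹' M) a = Phi M (ψ a) := by
  unfold Phi
  have m : MeasurableSet {p : H × H | p.1 ∈ M ∧ p.2 ∈ M ∧ ψ a + p.1 + p.2 ∈ M} :=
    (measurable_fst hM).inter ((measurable_snd hM).inter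
      ((by fun_prop : Measurable fun p : H × H => ψ a + p.1 + p.2) hM))
  rw [← (hψ.prod hψ).measure_preimage m.nullMeasurableSet]
  congr 1
  ext p
  simp

lemma Good.transfer (ψ : G ≃L[ℝ] H) {M : Set H} (hM : Good M) : Good (ψ ⁻¹' M) := by
  refine ⟨ψ.continuous.measurable hM.meas, hM.conv.linear_preimage ψ.toLinearMap, ?_⟩
  have := ψ.symm.lipschitz.isBounded_image hM.bdd
  rwa [ContinuousLinearEquiv.image_symm_eq_preimage] at this
end

lemma pre_Bl (ψ : EE (n + 1) ≃L[ℝ] ℝ × EE n)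
    (h : ∀ x, ‖x‖ ^ 2 = (ψ x).1 ^ 2 + ‖(ψ x).2‖ ^ 2) {R : ℝ} (hR : 0 ≤ R) :
    ψ ⁻¹' (Bl (EE n) R) = Metric.ball 0 R := by
  ext x
  rw [mem_ball_zero_iff, mem_preimage, ← sq_lt_sq₀ (norm_nonneg x) hR, h x]
  rfl

lemma sl_le {L : Set (ℝ × EE n)} {R : ℝ} (hR : 0 ≤ R) (h : L ⊆ Bl (EE n) R) (y : EE n) :
    volume (sl L y) ≤ ENNReal.ofReal (2 * R) := by
  have : sl L y ⊆ Ioo (-R) R := by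
    intro t ht
    have := h ht
    simp only [Bl, mem_ofPred_eq] at this
    rw [mem_Ioo, ← abs_lt]
    exact abs_lt_of_sq_lt_sq (by nlinarith [sq_nonneg ‖y‖]) hR
  refine (measure_mono this).trans ?_
  rw [Real.volume_Ioo]
  apply le_of_eq
  congr 1; ring

lemma ball_good (r : ℝ) : Good (Metric.ball (0 : EE (n + 1)) r) :=
  ⟨Metric.isOpen_ball.measurableSet, convex_ball _ _, Metric.isBounded_ball⟩

lemma step {L : Set (EE (n + 1))} (hL : Good L) {r R : ℝ} (hr : 0 ≤ r) (hrR : r ≤ R)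
    (hLR : L ⊆ Metric.ball 0 R) (a : EE (n + 1)) (e : EE (n + 1)) (he : ‖e‖ = 1) :
    ∃ (L' : Set (EE (n + 1))) (a' : EE (n + 1)), Good L' ∧ L' ⊆ Metric.ball 0 R ∧ volume L' = volume L ∧ Phi L a ≤ Phi L' a' ∧
      ENNReal.ofReal (2 * R) * volume (L ∩ Metric.ball 0 r) +
        ∫⁻ t : ℝ, volume ((L \ Metric.ball 0 r) ∩ (fun z => z + t • e) ⁻¹' (Metric.ball 0 r \ L))
      ≤ ENNReal.ofReal (2 * R) * volume (L' ∩ Metric.ball 0 r) := by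
  obtain ⟨ψ, hψ, hψe, hψn⟩ := exists_psi e he
  have hR := hr.trans hrR
  set M : Set (ℝ × EE n) := ψ.symm ⁻¹' L with hMdef
  have hM : Good M := hL.transfer ψ.symm
  have hML : ψ ⁻¹' M = L := by ext x; simp [hMdef]
  have eR := pre_Bl ψ hψn hR
  have er := pre_Bl ψ hψn hr
  have surj : Function.Surjective ψ := ψ.surjective
  have hMR : M ⊆ Bl (EE n) R := by
    rw [← surj.preimage_subset_preimage_iff, hML, eR]; exact hLR
  have hBR : Bl (EE n) r ⊆ Bl (EE n) R := by
    rw [← surj.preimage_subset_preimage_iff, er, eR]; exact Metric.ball_subset_ball hrR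
  have hBg : Good (Bl (EE n) r) := by
    have := (ball_good (n := n) r).transfer ψ.symm
    rw [← er] at this
    have e2 : ψ.symm ⁻¹' (ψ ⁻¹' Bl (EE n) r) = Bl (EE n) r := by ext x; simp
    rwa [e2] at this
  have vp {X : Set (ℝ × EE n)} (hX : MeasurableSet X) : volume (ψ ⁻¹' X) = volume X :=
    hψ.measure_preimage hX.nullMeasurableSet
  have hSM := hM.St hMR
  refine ⟨ψ ⁻¹' (St M), ψ.symm (0, (ψ a).2), hSM.transfer ψ, ?_, ?_, ?_, ?_⟩
  · rw [← eR]; exact preimage_mono (St_sub hMR)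
  · rw [vp hSM.meas, vol_St hM, ← hML, vp hM.meas]
  · rw [Phi_transfer ψ hψ hSM.meas, ← hML, Phi_transfer ψ hψ hM.meas]
    simpa using Phi_le hM (ψ a)
  · have g := gain hM hBg (St_Bl r) (sl_le hR hMR) (sl_le hR hBR)
    rw [cross_eq (hM.meas.diff hBg.meas) (hBg.meas.diff hM.meas)] at g
    have q : ∀ t : ℝ, volume ((L \ Metric.ball 0 r) ∩
        (fun z => z + t • e) ⁻¹' (Metric.ball 0 r \ L)) =
        volume ((M \ Bl (EE n) r) ∩ (fun z => z + (t, 0)) ⁻¹' (Bl (EE n) r \ M)) := by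
      intro t
      rw [← vp ((hM.meas.diff hBg.meas).inter
        ((by fun_prop : Measurable fun z : ℝ × EE n => z + (t, 0)) (hBg.meas.diff hM.meas)))]
      rw [← er, ← hML]
      congr 1
      ext x
      simp [hψe]
    simp only [q]
    rw [← er, ← preimage_inter, vp (hSM.meas.inter hBg.meas)]
    nth_rw 1 [← hML]
    rw [← preimage_inter, vp (hM.meas.inter hBg.meas)]
    exact g

lemma ball_shift {r : ℝ} (hr : 0 ≤ r) (a : EE (n + 1)) :
    Phi (Metric.ball (0 : EE (n + 1)) r) a ≤ Phi (Metric.ball (0 : EE (n + 1)) r) 0 := by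
  rcases eq_or_ne a 0 with rfl | ha
  · rfl
  have hn : ‖a‖ ≠ 0 := norm_ne_zero_iff.2 ha
  obtain ⟨ψ, hψ, hψe, hψn⟩ := exists_psi (‖a‖⁻¹ • a) (by simp [norm_smul, hn])
  have e0 : ψ a = (‖a‖, 0) := by
    have : a = ‖a‖ • (‖a‖⁻¹ • a) := by simp [smul_smul, hn]
    rw [this, map_smul, hψe]
    simp [hn]
  have er := pre_Bl ψ hψn hr
  have hBg : Good (Bl (EE n) r) := by
    have := (ball_good (n := n) r).transfer ψ.symm
    rw [← er] at this
    have e2 : ψ.symm ⁻¹' (ψ ⁻¹' Bl (EE n) r) = Bl (EE n) r := by ext x; simp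
    rwa [e2] at this
  rw [← er, Phi_transfer ψ hψ hBg.meas, Phi_transfer ψ hψ hBg.meas]
  have := Phi_le hBg (ψ a)
  rw [St_Bl, e0] at this
  rw [e0, map_zero]
  exact this

lemma polar (G : EE (n + 1) → ℝ≥0∞) (hG : Measurable G) {ρ : ℝ}
    (h0 : ∀ w, ρ ≤ ‖w‖ → G w = 0) :
    ∫⁻ w, G w ≤ ∫⁻ e : Metric.sphere (0 : EE (n + 1)) 1,
      (ENNReal.ofReal (ρ ^ n) * ∫⁻ t : ℝ, G (t • (e : EE (n + 1))))
        ∂(volume : Measure (EE (n + 1))).toSphere := by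
  have mp := (volume : Measure (EE (n + 1))).measurePreserving_homeomorphUnitSphereProd
  have hd : Module.finrank ℝ (EE (n + 1)) - 1 = n := by simp
  rw [hd] at mp
  have m0 : MeasurableSet ({0}ᶜ : Set (EE (n + 1))) := (measurableSet_singleton _).compl
  have e1 : ∫⁻ w, G w = ∫⁻ w in ({0}ᶜ : Set (EE (n + 1))), G w := by
    rw [setLIntegral_congr (ae_eq_univ.2 (by simp)), setLIntegral_univ]
  have e2 : ∀ w : ({0}ᶜ : Set (EE (n + 1))), G w =
      (fun q : Metric.sphere (0 : EE (n + 1)) 1 × Ioi (0 : ℝ) => G ((q.2 : ℝ) • (q.1 : EE (n + 1))))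
        (homeomorphUnitSphereProd (EE (n + 1)) w) := by
    intro w
    simp only
    rw [← homeomorphUnitSphereProd_symm_apply_coe]
    simp
  have mG : Measurable (fun q : Metric.sphere (0 : EE (n + 1)) 1 × Ioi (0 : ℝ) =>
      G ((q.2 : ℝ) • (q.1 : EE (n + 1)))) := by fun_prop
  rw [e1, ← lintegral_subtype_comap m0]
  simp only [e2]
  rw [mp.lintegral_comp mG, lintegral_prod _ mG.aemeasurable]
  refine lintegral_mono fun e => ?_
  have mg : Measurable fun t : ℝ => G (t • (e : EE (n + 1))) := by fun_prop
  rw [Measure.volumeIoiPow, lintegral_withDensity_eq_lintegral_mul _ (by fun_prop) (by fun_prop)]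
  simp only [Pi.mul_apply]
  rw [lintegral_subtype_comap measurableSet_Ioi
    (fun t : ℝ => ENNReal.ofReal (t ^ n) * G (t • (e : EE (n + 1)))), ← lintegral_const_mul _ mg]
  refine (setLIntegral_mono' measurableSet_Ioi fun t ht => ?_).trans (setLIntegral_le_lintegral _ _)
  have ht' : 0 < t := ht
  by_cases h : ρ ≤ t
  · rw [h0]
    · simp
    · simpa [norm_smul, abs_of_pos ht'] using h
  · push Not at h
    gcongr

end Euclid

/-! ### Choice of the direction and conclusion -/

section Final
variable {n : ℕ}

lemma exists_dir (n : ℕ) {R : ℝ} (hR : 0 < R) :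
    ∃ C : ℝ≥0∞, C ≠ 0 ∧ C ≠ ∞ ∧ ∀ D D' : Set (EE (n + 1)), MeasurableSet D → MeasurableSet D' →
      D ⊆ Metric.ball 0 R → D' ⊆ Metric.ball 0 R →
      ∃ e : EE (n + 1), ‖e‖ = 1 ∧ volume D * volume D' ≤
        C * ∫⁻ t : ℝ, volume (D ∩ (fun z => z + t • e) ⁻¹' D') := by
  set κ : ℝ≥0∞ := ENNReal.ofReal ((2 * R) ^ n) * (volume : Measure (EE (n + 1))).toSphere univ
    with hκ
  have κf : κ ≠ ∞ := ENNReal.mul_ne_top ENNReal.ofReal_ne_top (measure_ne_top _ _)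
  have C0 : κ + 1 ≠ 0 := by simp
  have Cf : κ + 1 ≠ ∞ := by simp [κf]
  refine ⟨κ + 1, C0, Cf, fun D D' hD hD' hDR hDR' => ?_⟩
  set P := volume D * volume D'
  have fD : volume D ≠ ∞ := (Metric.isBounded_ball.subset hDR).measure_lt_top.ne
  have fD' : volume D' ≠ ∞ := (Metric.isBounded_ball.subset hDR').measure_lt_top.ne
  have fP : P ≠ ∞ := ENNReal.mul_ne_top fD fD'
  by_contra! H
  set G : EE (n + 1) → ℝ≥0∞ := fun w => volume (D ∩ (fun z => z + w) ⁻¹' D') with hG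
  have mS : MeasurableSet {q : EE (n + 1) × EE (n + 1) | q.2 ∈ D ∧ q.2 + q.1 ∈ D'} :=
    (measurable_snd hD).inter
      ((by fun_prop : Measurable fun q : EE (n + 1) × EE (n + 1) => q.2 + q.1) hD')
  have mG : Measurable G := measurable_measure_prodMk_left mS
  have iG : ∫⁻ w, G w = P := by
    have : ∀ w, G w = volume (Prod.mk w ⁻¹'
      {q : EE (n + 1) × EE (n + 1) | q.2 ∈ D ∧ q.2 + q.1 ∈ D'}) := fun w => rfl
    simp only [this]
    rw [← Measure.prod_apply mS, Measure.prod_apply_symm mS]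
    have : ∀ s, volume ((fun t => (t, s)) ⁻¹'
        {q : EE (n + 1) × EE (n + 1) | q.2 ∈ D ∧ q.2 + q.1 ∈ D'})
        = D.indicator (fun _ => volume D') s := by
      intro s
      by_cases hs : s ∈ D
      · rw [indicator_of_mem hs, ← measure_preimage_add volume s D']
        congr 1
        ext t
        simp [hs]
      · simp [hs]
    simp only [this]
    rw [lintegral_indicator_const hD, mul_comm]
  have G0 : ∀ w, 2 * R ≤ ‖w‖ → G w = 0 := by
    intro w hw
    have : D ∩ (fun z => z + w) ⁻¹' D' = ∅ := by
      ext z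
      simp only [mem_inter_iff, mem_preimage, mem_empty_iff_false, iff_false, not_and]
      intro h1 h2
      have h1' := mem_ball_zero_iff.1 (hDR h1)
      have h2' := mem_ball_zero_iff.1 (hDR' h2)
      have : ‖w‖ ≤ ‖z + w‖ + ‖z‖ := by
        have := norm_sub_le (z + w) z
        simpa using this
      linarith
    simp [hG, this]
  have key := polar G mG G0
  rw [iG] at key
  set Q := P / (κ + 1) with hQ
  have CQ : (κ + 1) * Q = P := ENNReal.mul_div_cancel C0 Cf
  have le : P ≤ κ * Q := by
    refine key.trans ?_
    calc _ ≤ ∫⁻ e : Metric.sphere (0 : EE (n + 1)) 1, ENNReal.ofReal ((2 * R) ^ n) * Q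
          ∂(volume : Measure (EE (n + 1))).toSphere := by
          refine lintegral_mono fun e => ?_
          gcongr
          rw [hQ, ENNReal.le_div_iff_mul_le (Or.inl C0) (Or.inl Cf), mul_comm]
          exact (H e (by simp)).le
      _ = κ * Q := by rw [lintegral_const, hκ]; ring
  have fQ : Q ≠ ∞ := ENNReal.div_ne_top fP C0
  have Q0 : Q = 0 := by
    have h : κ * Q + Q ≤ κ * Q + 0 := by
      rw [← CQ, add_mul, one_mul] at le
      simpa using le
    simpa using (ENNReal.add_le_add_iff_left (ENNReal.mul_ne_top κf fQ)).1 h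
  have P0 : P = 0 := by rw [← CQ, Q0, mul_zero]
  have := H (EuclideanSpace.single 0 1) (by simp)
  simp [P0] at this

/-- the class of admissible bodies -/
def Cl (R : ℝ) (c : ℝ≥0∞) (L : Set (EE (n + 1))) : Prop :=
  Good L ∧ L ⊆ Metric.ball 0 R ∧ volume L = 1 ∧ ∃ a, c ≤ Phi L a

lemma improve {r R : ℝ} (hr : 0 ≤ r) (hR : 0 < R) (hrR : r ≤ R)
    (hB : volume (Metric.ball (0 : EE (n + 1)) r) = 1) (c : ℝ≥0∞) :
    ∃ k : ℝ, 0 < k ∧ ∀ L : Set (EE (n + 1)), Cl R c L → ∃ L' : Set (EE (n + 1)), Cl R c L' ∧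
      volume.real (L' \ Metric.ball 0 r) ≤
        volume.real (L \ Metric.ball 0 r) - k * volume.real (L \ Metric.ball 0 r) ^ 2 := by
  obtain ⟨C, C0, Cf, hC⟩ := exists_dir n hR
  have C0' : 0 < C.toReal := ENNReal.toReal_pos C0 Cf
  refine ⟨1 / (C.toReal * (2 * R)), by positivity, ?_⟩
  rintro L ⟨hL, hLR, hL1, a, ha⟩
  set B := Metric.ball (0 : EE (n + 1)) r with hBdef
  have mB : MeasurableSet B := Metric.isOpen_ball.measurableSet
  obtain ⟨e, he, hE⟩ := hC (L \ B) (B \ L) (hL.meas.diff mB) (mB.diff hL.meas)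
    (sdiff_subset.trans hLR) (sdiff_subset.trans (Metric.ball_subset_ball hrR))
  obtain ⟨L', a', hL', hLR', hv', hP, hg⟩ := step hL hr hrR hLR a e he
  refine ⟨L', ⟨hL', hLR', hv'.trans hL1, a', ha.trans hP⟩, ?_⟩
  set I := ∫⁻ t : ℝ, volume ((L \ B) ∩ (fun z => z + t • e) ⁻¹' (B \ L))
  have r1 : volume.real (L ∩ B) + volume.real (L \ B) = 1 := by
    rw [measureReal_inter_add_sdiff mB (by simp [hL1]), measureReal_def, hL1]; simp
  have r2 : volume.real (L ∩ B) + volume.real (B \ L) = 1 := by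
    rw [inter_comm, measureReal_inter_add_sdiff hL.meas (by simp [hB]), measureReal_def, hB]; simp
  have r3 : volume.real (L' ∩ B) + volume.real (L' \ B) = 1 := by
    rw [measureReal_inter_add_sdiff mB (by simp [hv', hL1]), measureReal_def, hv', hL1]; simp
  have f3 : ENNReal.ofReal (2 * R) * volume (L' ∩ B) ≠ ∞ :=
    ENNReal.mul_ne_top ENNReal.ofReal_ne_top
      (ne_top_of_le_ne_top (by simp [hB]) (measure_mono inter_subset_right))
  have fI : I ≠ ∞ := ne_top_of_le_ne_top f3 (le_add_self.trans hg)
  have f1 : ENNReal.ofReal (2 * R) * volume (L ∩ B) ≠ ∞ :=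
    ne_top_of_le_ne_top f3 (le_self_add.trans hg)
  have g1 := (ENNReal.toReal_le_toReal (ENNReal.add_ne_top.2 ⟨f1, fI⟩) f3).2 hg
  rw [ENNReal.toReal_add f1 fI, ENNReal.toReal_mul, ENNReal.toReal_mul,
    ENNReal.toReal_ofReal (by positivity)] at g1
  have g2 := ENNReal.toReal_mono (ENNReal.mul_ne_top Cf fI) hE
  rw [ENNReal.toReal_mul, ENNReal.toReal_mul] at g2
  simp only [← measureReal_def] at g1 g2
  set v := volume.real (L ∩ B)
  set δ := volume.real (L \ B)
  have hδ : volume.real (B \ L) = δ := by linarith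
  rw [hδ] at g2
  set δ' := volume.real (L' \ B)
  have h1 : 2 * R * δ' + I.toReal ≤ 2 * R * δ := by nlinarith
  have h2 : δ * δ / C.toReal ≤ I.toReal := by
    rw [div_le_iff₀ C0']; linarith
  have h3 : 2 * R * δ' ≤ 2 * R * (δ - 1 / (C.toReal * (2 * R)) * δ ^ 2) := by
    have : 2 * R * (δ - 1 / (C.toReal * (2 * R)) * δ ^ 2) = 2 * R * δ - δ * δ / C.toReal := by
      field_simp
    linarith
  exact le_of_mul_le_mul_left h3 (by positivity)

lemma approx {r R : ℝ} (hr : 0 ≤ r) (hR : 0 < R) (hrR : r ≤ R)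
    (hB : volume (Metric.ball (0 : EE (n + 1)) r) = 1) (c : ℝ≥0∞)
    {K : Set (EE (n + 1))} (hK : Cl R c K) {ε : ℝ} (hε : 0 < ε) :
    ∃ L : Set (EE (n + 1)), Cl R c L ∧ volume.real (L \ Metric.ball 0 r) < ε := by
  obtain ⟨k, hk, H⟩ := improve hr hR hrR hB c
  set S : Set ℝ := {x | ∃ L : Set (EE (n + 1)), Cl R c L ∧ volume.real (L \ Metric.ball 0 r) = x}
  have Sne : S.Nonempty := ⟨_, K, hK, rfl⟩
  have Sb : BddBelow S := ⟨0, by rintro x ⟨L, -, rfl⟩; exact measureReal_nonneg⟩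
  have S0 : 0 ≤ sInf S := Real.sInf_nonneg (by rintro x ⟨L, -, rfl⟩; exact measureReal_nonneg)
  have : sInf S = 0 := by
    by_contra hne
    have hpos : 0 < sInf S := lt_of_le_of_ne S0 (Ne.symm hne)
    obtain ⟨x, ⟨L, hL, rfl⟩, hx⟩ := exists_lt_of_csInf_lt Sne
      (show sInf S < sInf S + k * sInf S ^ 2 by nlinarith [mul_pos hk (pow_pos hpos 2)])
    obtain ⟨L', hL', hle⟩ := H L hL
    have h1 : sInf S ≤ volume.real (L' \ Metric.ball 0 r) := csInf_le Sb ⟨L', hL', rfl⟩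
    have h2 : sInf S ≤ volume.real (L \ Metric.ball 0 r) := csInf_le Sb ⟨L, hL, rfl⟩
    have h3 : sInf S ^ 2 ≤ volume.real (L \ Metric.ball 0 r) ^ 2 := by gcongr
    nlinarith [mul_le_mul_of_nonneg_left h3 hk.le]
  obtain ⟨x, ⟨L, hL, rfl⟩, hx⟩ := exists_lt_of_csInf_lt Sne (this.trans_lt hε)
  exact ⟨L, hL, hx⟩

lemma Phi_close {L B : Set (EE (n + 1))} (hL : MeasurableSet L) (hB : MeasurableSet B)
    (h1 : volume L = 1) (a : EE (n + 1)) :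
    Phi L a ≤ Phi B a + 3 * volume (L \ B) := by
  unfold Phi
  set D := L \ B with hD
  have mD : MeasurableSet D := hL.diff hB
  have sub : {p : EE (n + 1) × EE (n + 1) | p.1 ∈ L ∧ p.2 ∈ L ∧ a + p.1 + p.2 ∈ L} ⊆
      (({p : EE (n + 1) × EE (n + 1) | p.1 ∈ B ∧ p.2 ∈ B ∧ a + p.1 + p.2 ∈ B} ∪ D ×ˢ L) ∪ L ×ˢ D) ∪
        {p | p.1 ∈ L ∧ a + p.1 + p.2 ∈ D} := by
    rintro ⟨x, y⟩ ⟨hx, hy, hz⟩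
    simp only [mem_union, mem_prod, mem_ofPred_eq, hD, mem_sdiff]
    simp only at hx hy hz
    tauto
  have m3 : MeasurableSet {p : EE (n + 1) × EE (n + 1) | p.1 ∈ L ∧ a + p.1 + p.2 ∈ D} :=
    (measurable_fst hL).inter
      ((by fun_prop : Measurable fun q : EE (n + 1) × EE (n + 1) => a + q.1 + q.2) mD)
  have v3 : (volume.prod volume) {p : EE (n + 1) × EE (n + 1) | p.1 ∈ L ∧ a + p.1 + p.2 ∈ D}
      = volume D := by
    rw [Measure.prod_apply m3]
    have : ∀ s, volume (Prod.mk s ⁻¹'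
        {p : EE (n + 1) × EE (n + 1) | p.1 ∈ L ∧ a + p.1 + p.2 ∈ D})
        = L.indicator (fun _ => volume D) s := by
      intro s
      by_cases hs : s ∈ L
      · rw [indicator_of_mem hs, ← measure_preimage_add volume (a + s) D]
        congr 1
        ext t
        simp [hs]
      · simp [hs]
    simp only [this]
    rw [lintegral_indicator_const hL, h1, mul_one]
  refine (measure_mono sub).trans ?_
  refine (measure_union_le _ _).trans ?_
  rw [v3]
  refine (add_le_add_left ((measure_union_le _ _).trans
    (add_le_add_left (measure_union_le _ _) _)) _).trans ?_
  rw [Measure.prod_prod, Measure.prod_prod, h1, mul_one, one_mul]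
  apply le_of_eq
  ring

theorem main {r : ℝ} {K : Set (EE (n + 1))} (hK : Good K) (hK1 : volume K = 1)
    (hr : 0 ≤ r) (hB : volume (Metric.ball (0 : EE (n + 1)) r) = 1) (a : EE (n + 1)) :
    Phi K a ≤ Phi (Metric.ball (0 : EE (n + 1)) r) 0 := by
  obtain ⟨R0, hR0⟩ := hK.bdd.subset_ball 0
  set R := max (max R0 r) 1
  have hR : 0 < R := lt_of_lt_of_le one_pos (le_max_right _ _)
  have hrR : r ≤ R := (le_max_right _ _).trans (le_max_left _ _)
  have hKC : Cl R (Phi K a) K :=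
    ⟨hK, hR0.trans (Metric.ball_subset_ball ((le_max_left _ _).trans (le_max_left _ _))), hK1,
      a, le_rfl⟩
  refine ENNReal.le_of_forall_pos_le_add fun ε hε _ => ?_
  obtain ⟨L, ⟨hL, hLR, hL1, b, hb⟩, hlt⟩ := approx hr hR hrR hB _ hKC
    (ε := (ε : ℝ) / 3) (by positivity)
  refine hb.trans ((Phi_close (B := Metric.ball 0 r) hL.meas Metric.isOpen_ball.measurableSet hL1 b).trans ?_)
  refine add_le_add (ball_shift hr b) ?_
  have fD : volume (L \ Metric.ball 0 r) ≠ ∞ :=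
    ne_top_of_le_ne_top (by simp [hL1]) (measure_mono sdiff_subset)
  rw [← ENNReal.toReal_le_toReal (ENNReal.mul_ne_top (by simp) fD) (by simp), ENNReal.toReal_mul]
  rw [measureReal_def] at hlt
  simp
  linarith

end Final
end Rz

theorem stmt_7 (d : ℕ) (K B : Set (EuclideanSpace ℝ (Fin d)))
    (hKc : IsCompact K) (hKconv : Convex ℝ K) (hKsym : ∀ x ∈ K, -x ∈ K)
    (hKvol : volume K = 1)
    (r : ℝ) (hB : B = Metric.closedBall 0 r) (hBvol : volume B = 1)
    (a : EuclideanSpace ℝ (Fin d)) :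
    (volume.restrict K).prod (volume.restrict K) {p | a + p.1 + p.2 ∈ K}
      ≤ (volume.restrict B).prod (volume.restrict B) {p | p.1 + p.2 ∈ B} := by
  have hBne : B.Nonempty := nonempty_of_measure_ne_zero (μ := volume) (by simp [hBvol])
  have hKne : K.Nonempty := nonempty_of_measure_ne_zero (μ := volume) (by simp [hKvol])
  cases d with
  | zero =>
    rw [hBne.eq_univ, hKne.eq_univ]
    simp
  | succ n =>
    have hr : 0 ≤ r := by rw [hB] at hBne; exact Metric.nonempty_closedBall.1 hBne
    have hb : volume (Metric.ball (0 : EuclideanSpace ℝ (Fin (n + 1))) r) = 1 := by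
      rw [← Measure.addHaar_closedBall_eq_addHaar_ball, ← hB, hBvol]
    have hKg : Rz.Good K := ⟨hKc.measurableSet, hKconv, hKc.isBounded⟩
    have key := Rz.main hKg hKvol hr hb a
    have mB : MeasurableSet B := by rw [hB]; exact Metric.isClosed_closedBall.measurableSet
    have q : ∀ (X : Set (EuclideanSpace ℝ (Fin (n + 1)))) (b : EuclideanSpace ℝ (Fin (n + 1))),
        MeasurableSet X → (volume.restrict X).prod (volume.restrict X) {p | b + p.1 + p.2 ∈ X}
          = Rz.Phi X b := by
      intro X b hX
      have mm : MeasurableSet {p : EuclideanSpace ℝ (Fin (n + 1)) ×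
          EuclideanSpace ℝ (Fin (n + 1)) | b + p.1 + p.2 ∈ X} :=
        (by fun_prop : Measurable fun p : EuclideanSpace ℝ (Fin (n + 1)) ×
          EuclideanSpace ℝ (Fin (n + 1)) => b + p.1 + p.2) hX
      rw [Measure.prod_restrict, Measure.restrict_apply mm, Rz.Phi]
      congr 1
      ext p
      simp only [Set.mem_inter_iff, Set.mem_ofPred_eq, Set.mem_prod]
      tauto
    have q0 := q B 0 mB
    simp only [zero_add] at q0
    rw [q K a hKg.meas, q0]
    refine key.trans (measure_mono ?_)
    have sub : Metric.ball 0 r ⊆ B := by rw [hB]; exact Metric.ball_subset_closedBall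
    rintro p ⟨h1, h2, h3⟩
    exact ⟨sub h1, sub h2, sub h3⟩
end

section
/- Let K ⊂ ℝ^d be compact, convex, symmetric with |K| = 1, let X_K, X'_K be i.i.d. uniform on K, let η > 0 and set G(d,K,η) = {z ∈ ℝ^d : P(z + X'_K ∉ K) ≥ 1 - η}. Then for any a ∈ ℝ^d, P(a + X_K ∉ G(d,K,η)) ≤ η^{-1} P(X_B + X'_B ∈ B), where B is the Euclidean ball of volume 1 in ℝ^d and X_B, X'_B are i.i.d. uniform on B. -/
open MeasureTheory ProbabilityTheory
open scoped ENNReal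

namespace RieszAux

/-- Indicator with values in `ℝ≥0∞`. -/
noncomputable abbrev ind {α : Type*} (A : Set α) : α → ℝ≥0∞ := A.indicator 1

lemma ind_meas {α : Type*} [MeasurableSpace α] {A : Set α} (hA : MeasurableSet A) :
    Measurable (ind A) := measurable_one.indicator hA

lemma ind_le_one {α : Type*} (A : Set α) (x : α) : ind A x ≤ 1 := by
  unfold ind; by_cases h : x ∈ A <;> simp [h]

/-! ### One dimensional part -/

/-- overlap function -/
noncomputable def phi (p q σ : ℝ) : ℝ≥0∞ := ENNReal.ofReal (min p (σ + q) - max (-p) (σ - q))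

lemma phi_anti {p q σ σ' : ℝ} (h : |σ| ≤ |σ'|) : phi p q σ' ≤ phi p q σ := by
  unfold phi
  apply ENNReal.ofReal_le_ofReal
  have h1 := abs_le.1 h
  rcases abs_cases σ' with h2 | h2 <;>
  rcases min_cases p (σ + q) with h3 | h3 <;> rcases max_cases (-p) (σ - q) with h4 | h4 <;>
  rcases min_cases p (σ' + q) with h5 | h5 <;> rcases max_cases (-p) (σ' - q) with h6 | h6 <;>
  linarith [h1.1, h1.2]

lemma phi_meas (p q : ℝ) : Measurable (phi p q) := by
  unfold phi; fun_prop

lemma phi_eq (p q σ : ℝ) : ∫⁻ s, ind (Metric.closedBall 0 p) s * ind (Metric.closedBall 0 q) (σ - s)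
    = phi p q σ := by
  have : ∀ s : ℝ, ind (Metric.closedBall 0 p) s * ind (Metric.closedBall 0 q) (σ - s)
      = (Set.Icc (max (-p) (σ - q)) (min p (σ + q))).indicator 1 s := by
    intro s
    classical
    unfold ind
    rw [Set.indicator_apply, Set.indicator_apply, Set.indicator_apply]
    have : s ∈ Set.Icc (max (-p) (σ - q)) (min p (σ + q)) ↔
        s ∈ Metric.closedBall 0 p ∧ σ - s ∈ Metric.closedBall 0 q := by
      simp only [Set.mem_Icc, max_le_iff, le_min_iff, Metric.mem_closedBall, dist_zero_right,
        Real.norm_eq_abs, abs_le]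
      constructor
      · rintro ⟨⟨_, _⟩, _, _⟩; refine ⟨⟨?_, ?_⟩, ?_, ?_⟩ <;> linarith
      · rintro ⟨⟨_, _⟩, _, _⟩; refine ⟨⟨?_, ?_⟩, ?_, ?_⟩ <;> linarith
    by_cases h1 : s ∈ Metric.closedBall (0:ℝ) p <;>
      by_cases h2 : σ - s ∈ Metric.closedBall (0:ℝ) q <;> simp only [this, h1, h2] <;> simp
  simp_rw [this]
  rw [lintegral_indicator_one measurableSet_Icc, Real.volume_Icc, phi]

lemma bathtub (p q c m : ℝ) :
    ∫⁻ σ in Metric.closedBall c m, phi p q σ ≤ ∫⁻ σ in Metric.closedBall 0 m, phi p q σ := by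
  set A := Metric.closedBall c m
  set D := Metric.closedBall (0:ℝ) m
  have hA : MeasurableSet A := Metric.isClosed_closedBall.measurableSet
  have hD : MeasurableSet D := Metric.isClosed_closedBall.measurableSet
  have hv : volume (A \ D) = volume (D \ A) := by
    have e : volume A = volume D := by simp [A, D]
    have f1 : volume (A ∩ D) ≠ ∞ := measure_ne_top_of_subset Set.inter_subset_left ((isCompact_closedBall c m).measure_ne_top)
    have h1 := measure_inter_add_sdiff (μ := volume) A hD
    have h2 := measure_inter_add_sdiff (μ := volume) D hA
    rw [Set.inter_comm] at h2
    rw [← h2, ← h1] at e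
    exact (ENNReal.add_right_inj f1).1 e
  rw [← lintegral_inter_add_sdiff _ A hD, ← lintegral_inter_add_sdiff _ D hA, Set.inter_comm D A]
  gcongr 1
  rcases lt_or_ge m 0 with hm | hm
  · simp [A, Metric.closedBall_eq_empty.2 hm]
  calc ∫⁻ σ in A \ D, phi p q σ ≤ ∫⁻ σ in A \ D, phi p q m := by
        apply setLIntegral_mono' (hA.diff hD)
        intro x hx
        apply phi_anti
        have := hx.2
        simp only [D, Metric.mem_closedBall, dist_zero_right, Real.norm_eq_abs, not_le] at this
        rw [abs_of_nonneg hm]; exact this.le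
    _ = ∫⁻ σ in D \ A, phi p q m := by simp [hv]
    _ ≤ _ := by
        apply setLIntegral_mono' (hD.diff hA)
        intro x hx
        apply phi_anti
        have := hx.1
        simp only [D, Metric.mem_closedBall, dist_zero_right, Real.norm_eq_abs] at this
        rwa [abs_of_nonneg hm]

/-- one dimensional triple integral -/
noncomputable def T (I J M : Set ℝ) : ℝ≥0∞ := ∫⁻ s, ∫⁻ t, ind I s * ind J t * ind M (s + t)

lemma T_congr {I J M I' J' M' : Set ℝ} (hI : I =ᵐ[volume] I') (hJ : J =ᵐ[volume] J')
    (hM : M =ᵐ[volume] M') : T I J M = T I' J' M' := by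
  unfold T
  apply lintegral_congr_ae
  have hI' := indicator_ae_eq_of_ae_eq_set (f := (1 : ℝ → ℝ≥0∞)) hI
  have hJ' := indicator_ae_eq_of_ae_eq_set (f := (1 : ℝ → ℝ≥0∞)) hJ
  have hM' := indicator_ae_eq_of_ae_eq_set (f := (1 : ℝ → ℝ≥0∞)) hM
  filter_upwards [hI'] with s hs
  apply lintegral_congr_ae
  have := (measurePreserving_add_left (volume : Measure ℝ) s).quasiMeasurePreserving.ae_eq_comp hM'
  filter_upwards [hJ', this] with t ht ht2
  simp only [Function.comp] at ht2
  simp only [ind]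
  rw [hs, ht, ht2]

lemma T_ball (c₁ c₂ c₃ p q m : ℝ) :
    T (Metric.closedBall c₁ p) (Metric.closedBall c₂ q) (Metric.closedBall c₃ m)
      = ∫⁻ σ in Metric.closedBall (c₃ - c₁ - c₂) m, phi p q σ := by
  have hm : ∀ c p : ℝ, Measurable (ind (Metric.closedBall c p)) := fun c p =>
    ind_meas Metric.isClosed_closedBall.measurableSet
  have hsh : ∀ c p b s : ℝ, ind (Metric.closedBall c p) (s + b)
      = ind (Metric.closedBall (c - b) p) s := by
    intro c p b s
    classical
    unfold ind
    rw [Set.indicator_apply, Set.indicator_apply]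
    have : s + b ∈ Metric.closedBall c p ↔ s ∈ Metric.closedBall (c - b) p := by
      simp only [Metric.mem_closedBall, Real.dist_eq]
      rw [show s + b - c = s - (c - b) by ring]
    simp only [this]; simp
  unfold T
  rw [← lintegral_add_right_eq_self _ c₁]
  have e1 : ∀ s : ℝ, ∫⁻ t, ind (Metric.closedBall c₁ p) (s + c₁) * ind (Metric.closedBall c₂ q) t *
        ind (Metric.closedBall c₃ m) (s + c₁ + t) =
      ∫⁻ σ, ind (Metric.closedBall (c₃ - c₁ - c₂) m) σ * (ind (Metric.closedBall 0 p) s *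
        ind (Metric.closedBall 0 q) (σ - s)) := by
    intro s
    rw [← lintegral_add_right_eq_self _ (c₂ - s)]
    apply lintegral_congr
    intro t
    have : s + c₁ + (t + (c₂ - s)) = t + (c₁ + c₂) := by ring
    rw [this, show t + (c₂ - s) = (t - s) + c₂ by ring, hsh, hsh, hsh, sub_self, sub_self,
      sub_sub]
    ring
  simp_rw [e1]
  rw [lintegral_lintegral_swap]
  · have e2 : ∀ σ : ℝ, ∫⁻ s, ind (Metric.closedBall (c₃ - c₁ - c₂) m) σ *
        (ind (Metric.closedBall 0 p) s * ind (Metric.closedBall 0 q) (σ - s))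
        = (Metric.closedBall (c₃ - c₁ - c₂) m).indicator (phi p q) σ := by
      intro σ
      have h1 := hm 0 p
      have h2 := hm 0 q
      rw [lintegral_const_mul _ (by fun_prop), phi_eq]
      unfold ind
      by_cases h : σ ∈ Metric.closedBall (c₃ - c₁ - c₂) m <;> simp only [Set.indicator, h] <;> simp
    simp_rw [e2]
    rw [lintegral_indicator Metric.isClosed_closedBall.measurableSet]
  · have h1 := hm 0 p
    have h2 := hm 0 q
    have h3 := hm (c₃ - c₁ - c₂) m
    apply Measurable.aemeasurable
    unfold Function.uncurry
    fun_prop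

lemma riesz1 {I J M I' J' M' : Set ℝ} {c₁ c₂ c₃ c₁' c₂' c₃' p q m : ℝ}
    (hI : I =ᵐ[volume] Metric.closedBall c₁ p) (hJ : J =ᵐ[volume] Metric.closedBall c₂ q)
    (hM : M =ᵐ[volume] Metric.closedBall c₃ m)
    (hI' : I' =ᵐ[volume] Metric.closedBall c₁' p) (hJ' : J' =ᵐ[volume] Metric.closedBall c₂' q)
    (hM' : M' =ᵐ[volume] Metric.closedBall c₃' m) (hc : c₃' = c₁' + c₂') :
    T I J M ≤ T I' J' M' := by
  rw [T_congr hI hJ hM, T_congr hI' hJ' hM', T_ball, T_ball, hc]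
  convert bathtub p q _ m using 4
  ring

lemma interval_struct {I : Set ℝ} (hc : Convex ℝ I) (hb : Bornology.IsBounded I) :
    ∃ c p : ℝ, 0 ≤ p ∧ Metric.ball c p ⊆ I ∧ I ⊆ Metric.closedBall c p := by
  rcases I.eq_empty_or_nonempty with rfl | hne
  · exact ⟨0, 0, le_rfl, by simp, by simp⟩
  refine ⟨(sInf I + sSup I) / 2, (sSup I - sInf I) / 2, ?_, ?_, ?_⟩
  · have := Real.sInf_le_sSup I hb.bddBelow hb.bddAbove
    linarith
  · rw [← Real.Ioo_eq_ball]
    exact (IsConnected.Ioo_csInf_csSup_subset ⟨hne, hc.isPreconnected⟩) hb.bddBelow hb.bddAbove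
  · rw [← Real.Icc_eq_closedBall]
    exact subset_Icc_csInf_csSup hb.bddBelow hb.bddAbove

lemma ball_ae (c p : ℝ) : Metric.ball c p =ᵐ[volume] Metric.closedBall c p := by
  rw [Real.ball_eq_Ioo, Real.closedBall_eq_Icc]
  exact Ioo_ae_eq_Icc

lemma struct_ae {I : Set ℝ} {c p : ℝ} (h1 : Metric.ball c p ⊆ I) (h2 : I ⊆ Metric.closedBall c p) :
    I =ᵐ[volume] Metric.closedBall c p :=
  Filter.EventuallyLE.antisymm (LE.le.eventuallyLE h2)
    ((ball_ae c p).symm.le.trans (LE.le.eventuallyLE h1))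

lemma struct_vol {I : Set ℝ} {c p : ℝ} (h1 : Metric.ball c p ⊆ I)
    (h2 : I ⊆ Metric.closedBall c p) : volume I = ENNReal.ofReal (2 * p) := by
  rw [measure_congr (struct_ae h1 h2), Real.volume_closedBall]


/-! ### Steiner symmetrization -/

section Steiner

set_option linter.unusedSectionVars false

variable {E : Type*} [NormedAddCommGroup E] [InnerProductSpace ℝ E] [FiniteDimensional ℝ E]
  [MeasurableSpace E] [BorelSpace E]

/-- the slab `0 ≤ ⟪u, x⟫ ≤ 1` -/
def slab (u : E) : Set E := {x | inner ℝ u x ∈ Set.Icc (0:ℝ) 1}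

/-- measure on the slab -/
noncomputable def nu (u : E) : Measure E := volume.restrict (slab u)

instance (u : E) : SFinite (nu u) := by unfold nu; infer_instance

lemma slab_meas (u : E) : MeasurableSet (slab u) := by
  apply measurableSet_Icc.preimage
  fun_prop

lemma disint {u : E} (hu : ‖u‖ = 1) {f : E → ℝ≥0∞} (hf : Measurable f) :
    ∫⁻ x, f x = ∫⁻ x, (∫⁻ t : ℝ, f (x + t • u)) ∂(nu u) := by
  have hs := ind_meas (slab_meas u)
  have e0 : ∀ x : E, ∫⁻ t : ℝ, ind (slab u) (x - t • u) = 1 := by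
    intro x
    have : ∀ t : ℝ, ind (slab u) (x - t • u) =
        (Set.Icc (inner ℝ u x - 1) (inner ℝ u x)).indicator 1 t := by
      intro t
      classical
      unfold ind
      rw [Set.indicator_apply, Set.indicator_apply]
      have : x - t • u ∈ slab u ↔ t ∈ Set.Icc (inner ℝ u x - 1) (inner ℝ u x) := by
        simp only [slab, Set.mem_ofPred_eq, Set.mem_Icc, inner_sub_right, inner_smul_right,
          real_inner_self_eq_norm_sq, hu]
        constructor
        · rintro ⟨_, _⟩; constructor <;> linarith
        · rintro ⟨_, _⟩; constructor <;> linarith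
      simp only [this]; simp
    simp_rw [this]
    rw [lintegral_indicator_one measurableSet_Icc, Real.volume_Icc]
    simp
  calc ∫⁻ x, f x = ∫⁻ x, ∫⁻ t : ℝ, f x * ind (slab u) (x - t • u) := by
        apply lintegral_congr
        intro x
        rw [lintegral_const_mul _ (by fun_prop), e0, mul_one]
    _ = ∫⁻ t : ℝ, ∫⁻ x, f x * ind (slab u) (x - t • u) := by
        rw [lintegral_lintegral_swap]
        apply Measurable.aemeasurable
        unfold Function.uncurry
        fun_prop
    _ = ∫⁻ t : ℝ, ∫⁻ x, f (x + t • u) * ind (slab u) x := by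
        apply lintegral_congr
        intro t
        rw [← lintegral_add_right_eq_self _ (t • u)]
        simp
    _ = ∫⁻ x, ∫⁻ t : ℝ, f (x + t • u) * ind (slab u) x := by
        rw [lintegral_lintegral_swap]
        apply Measurable.aemeasurable
        unfold Function.uncurry
        fun_prop
    _ = _ := by
        unfold nu
        rw [← lintegral_indicator (slab_meas u)]
        apply lintegral_congr
        intro x
        rw [lintegral_mul_const _ (by fun_prop)]
        unfold ind
        by_cases h : x ∈ slab u <;> simp [h]

/-- the fibre of `L` through `x` in direction `u` -/
def fib (u : E) (L : Set E) (x : E) : Set ℝ := {t | x + t • u ∈ L}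

/-- Steiner symmetrization -/
def St (u : E) (L : Set E) : Set E := {x | ENNReal.ofReal (2 * |inner ℝ u x|) < volume (fib u L x)}

lemma fib_meas (u : E) {L : Set E} (hL : MeasurableSet L) (x : E) : MeasurableSet (fib u L x) := by
  apply hL.preimage; fun_prop

lemma vol_fib_meas (u : E) {L : Set E} (hL : MeasurableSet L) :
    Measurable fun x => volume (fib u L x) := by
  have : MeasurableSet {p : E × ℝ | p.1 + p.2 • u ∈ L} := by
    apply hL.preimage; fun_prop
  exact measurable_measure_prodMk_left this

lemma St_meas (u : E) {L : Set E} (hL : MeasurableSet L) : MeasurableSet (St u L) := by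
  apply measurableSet_lt _ (vol_fib_meas u hL)
  fun_prop

lemma vol_disint {u : E} (hu : ‖u‖ = 1) {L : Set E} (hL : MeasurableSet L) :
    volume L = ∫⁻ x, volume (fib u L x) ∂(nu u) := by
  rw [← lintegral_indicator_one hL, disint hu (ind_meas hL)]
  apply lintegral_congr
  intro x
  rw [← lintegral_indicator_one (fib_meas u hL x)]
  rfl

lemma fib_shift (u : E) (L : Set E) (x : E) (b : ℝ) :
    volume (fib u L (x + b • u)) = volume (fib u L x) := by
  have : fib u L (x + b • u) = (fun t => t + b) ⁻¹' (fib u L x) := by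
    ext t
    simp only [fib, Set.mem_ofPred_eq, Set.mem_preimage, add_smul]
    rw [add_assoc, add_comm (b • u)]
  rw [this, measure_preimage_add_right]

lemma fib_convex (u : E) {L : Set E} (hL : Convex ℝ L) (x : E) : Convex ℝ (fib u L x) := by
  intro s hs t ht α β hα hβ hαβ
  have := hL hs ht hα hβ hαβ
  simp only [fib, Set.mem_ofPred_eq] at *
  convert this using 1
  simp only [smul_add, smul_smul, add_smul, smul_eq_mul]
  have : x = α • x + β • x := by rw [← add_smul, hαβ, one_smul]
  nth_rewrite 1 [this]
  abel

lemma normsq {u : E} (hu : ‖u‖ = 1) (x : E) (t : ℝ) :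
    ‖x + t • u‖ ^ 2 = (t + inner ℝ u x) ^ 2 + ‖x‖ ^ 2 - (inner ℝ u x) ^ 2 := by
  rw [norm_add_sq_real, inner_smul_right, norm_smul, hu, real_inner_comm, mul_one,
    Real.norm_eq_abs, sq_abs]
  ring

lemma fib_bdd {u : E} (hu : ‖u‖ = 1) {L : Set E} {R : ℝ} (hL : L ⊆ Metric.closedBall 0 R) (x : E) :
    Bornology.IsBounded (fib u L x) := by
  rw [isBounded_iff_forall_norm_le]
  refine ⟨R + ‖x‖, fun t ht => ?_⟩
  have h := hL ht
  rw [mem_closedBall_zero_iff] at h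
  have : ‖t • u‖ ≤ ‖x + t • u‖ + ‖x‖ := by
    have := norm_sub_le (x + t • u) x
    simpa using this
  rw [norm_smul, hu, mul_one] at this
  linarith

lemma fib_struct {u : E} (hu : ‖u‖ = 1) {L : Set E} {R : ℝ} (hL : L ⊆ Metric.closedBall 0 R)
    (hc : Convex ℝ L) (x : E) :
    ∃ c p : ℝ, 0 ≤ p ∧ Metric.ball c p ⊆ fib u L x ∧ fib u L x ⊆ Metric.closedBall c p :=
  interval_struct (fib_convex u hc x) (fib_bdd hu hL x)

lemma fib_St {u : E} (hu : ‖u‖ = 1) {L : Set E} {x : E} {p : ℝ}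
    (hv : volume (fib u L x) = ENNReal.ofReal (2 * p)) :
    fib u (St u L) x = Metric.ball (-inner ℝ u x) p := by
  ext t
  simp only [fib, St, Set.mem_ofPred_eq, Metric.mem_ball, Real.dist_eq, sub_neg_eq_add]
  have := fib_shift u L x t
  simp only [fib] at this hv
  rw [this, hv, inner_add_right, inner_smul_right, real_inner_self_eq_norm_sq, hu,
    ENNReal.ofReal_lt_ofReal_iff_of_nonneg (by positivity)]
  rw [show inner ℝ u x + t * 1 ^ 2 = t + inner ℝ u x by ring]
  constructor <;> intro h <;> linarith

lemma vol_fib_St {u : E} (hu : ‖u‖ = 1) {L : Set E} {R : ℝ} (hL : L ⊆ Metric.closedBall 0 R)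
    (hc : Convex ℝ L) (x : E) : volume (fib u (St u L) x) = volume (fib u L x) := by
  obtain ⟨c, p, hp, h1, h2⟩ := fib_struct hu hL hc x
  have hv := struct_vol h1 h2
  rw [fib_St hu hv, hv, Real.volume_ball]

lemma vol_St {u : E} (hu : ‖u‖ = 1) {L : Set E} {R : ℝ} (hL : L ⊆ Metric.closedBall 0 R)
    (hc : Convex ℝ L) (hm : MeasurableSet L) : volume (St u L) = volume L := by
  rw [vol_disint hu hm, vol_disint hu (St_meas u hm)]
  simp_rw [vol_fib_St hu hL hc]

lemma St_subset {u : E} (hu : ‖u‖ = 1) {L : Set E} {R : ℝ} (hL : L ⊆ Metric.closedBall 0 R) :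
    St u L ⊆ Metric.closedBall 0 R := by
  intro y hy
  by_contra hcon
  rw [mem_closedBall_zero_iff, not_le] at hcon
  have : fib u L y ⊆ Metric.closedBall (-inner ℝ u y) |inner ℝ u y| := by
    intro t ht
    have h := hL ht
    rw [mem_closedBall_zero_iff] at h
    have h2 := normsq hu y t
    rw [Metric.mem_closedBall, Real.dist_eq, sub_neg_eq_add]
    apply sq_le_sq.1
    have h3 : ‖y + t • u‖ ^ 2 ≤ ‖y‖ ^ 2 := by
      have := h.trans hcon.le
      gcongr
    linarith
  have h1 := measure_mono (μ := volume) this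
  rw [Real.volume_closedBall] at h1
  exact absurd hy (not_lt.2 h1)

lemma St_convex {u : E} (hu : ‖u‖ = 1) {L : Set E} {R : ℝ} (hL : L ⊆ Metric.closedBall 0 R)
    (hc : Convex ℝ L) : Convex ℝ (St u L) := by
  rw [convex_iff_forall_pos]
  intro x hx y hy α β hα hβ hαβ
  obtain ⟨c, p, hp, h1, h2⟩ := fib_struct hu hL hc x
  obtain ⟨c', p', hp', h1', h2'⟩ := fib_struct hu hL hc y
  simp only [St, Set.mem_ofPred_eq] at hx hy ⊢
  rw [struct_vol h1 h2, ENNReal.ofReal_lt_ofReal_iff_of_nonneg (by positivity)] at hx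
  rw [struct_vol h1' h2', ENNReal.ofReal_lt_ofReal_iff_of_nonneg (by positivity)] at hy
  have hx' : |inner ℝ u x| < p := by linarith
  have hy' : |inner ℝ u y| < p' := by linarith
  have pp : 0 < p := (abs_nonneg _).trans_lt hx'
  have pp' : 0 < p' := (abs_nonneg _).trans_lt hy'
  set q := α * p + β * p' with hq
  have qp : 0 < q := by positivity
  have hsub : Metric.ball (α * c + β * c') q ⊆ fib u L (α • x + β • y) := by
    intro t ht
    rw [Metric.mem_ball, Real.dist_eq] at ht
    set e := t - (α * c + β * c') with he
    have k1 : c + e * p / q ∈ fib u L x := by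
      apply h1
      rw [Metric.mem_ball, Real.dist_eq, add_sub_cancel_left, abs_div, abs_mul, abs_of_pos pp,
        abs_of_pos qp, div_lt_iff₀ qp, mul_comm p]
      gcongr
    have k2 : c' + e * p' / q ∈ fib u L y := by
      apply h1'
      rw [Metric.mem_ball, Real.dist_eq, add_sub_cancel_left, abs_div, abs_mul, abs_of_pos pp',
        abs_of_pos qp, div_lt_iff₀ qp, mul_comm p']
      gcongr
    have k3 := hc k1 k2 hα.le hβ.le hαβ
    simp only [fib, Set.mem_ofPred_eq]
    have ht' : t = α * (c + e * p / q) + β * (c' + e * p' / q) := by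
      have : α * (e * p / q) + β * (e * p' / q) = e := by
        rw [hq]; rw [hq] at qp; field_simp
      linarith
    convert k3 using 1
    rw [ht']
    module
  refine lt_of_lt_of_le ?_ (measure_mono hsub)
  rw [Real.volume_ball, ENNReal.ofReal_lt_ofReal_iff (by positivity)]
  rw [inner_add_right, inner_smul_right, inner_smul_right]
  have : |α * inner ℝ u x + β * inner ℝ u y| ≤ α * |inner ℝ u x| + β * |inner ℝ u y| := by
    refine (abs_add_le _ _).trans ?_
    rw [abs_mul, abs_mul, abs_of_pos hα, abs_of_pos hβ]
  have i1 : α * |inner ℝ u x| < α * p := by gcongr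
  have i2 : β * |inner ℝ u y| < β * p' := by gcongr
  linarith

/-- The triple integral. -/
noncomputable def F (L : Set E) (a : E) : ℝ≥0∞ :=
  ∫⁻ x, ∫⁻ y, ind L x * ind L y * ind L (a + x + y)

lemma F_disint {u : E} (hu : ‖u‖ = 1) {L : Set E} (hm : MeasurableSet L) (a : E) :
    F L a = ∫⁻ x, ∫⁻ y, T (fib u L x) (fib u L y) (fib u L (a + x + y)) ∂(nu u) ∂(nu u) := by
  have hi := ind_meas hm
  unfold F
  rw [disint hu]
  · apply lintegral_congr
    intro x
    have : ∀ s : ℝ, ∫⁻ y, ind L (x + s • u) * ind L y * ind L (a + (x + s • u) + y) =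
        ∫⁻ y, (∫⁻ t : ℝ, ind L (x + s • u) * ind L (y + t • u) *
          ind L (a + (x + s • u) + (y + t • u))) ∂(nu u) := by
      intro s
      rw [disint hu]
      fun_prop
    simp_rw [this]
    rw [lintegral_lintegral_swap]
    · apply lintegral_congr
      intro y
      unfold T
      apply lintegral_congr
      intro s
      apply lintegral_congr
      intro t
      have e : a + (x + s • u) + (y + t • u) = a + x + y + (s + t) • u := by
        rw [add_smul]; abel
      rw [e]
      rfl
    · apply Measurable.aemeasurable
      apply Measurable.lintegral_prod_right
      unfold Function.uncurry
      fun_prop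
  · apply Measurable.lintegral_prod_right
    unfold Function.uncurry
    fun_prop

lemma F_le_St {u : E} (hu : ‖u‖ = 1) {L : Set E} {R : ℝ} (hL : L ⊆ Metric.closedBall 0 R)
    (hc : Convex ℝ L) (hm : MeasurableSet L) (a : E) :
    F L a ≤ F (St u L) (a - (inner ℝ u a : ℝ) • u) := by
  rw [F_disint hu hm, F_disint hu (St_meas u hm)]
  apply lintegral_mono
  intro x
  apply lintegral_mono
  intro y
  obtain ⟨c₁, p₁, -, h1, h1'⟩ := fib_struct hu hL hc x
  obtain ⟨c₂, p₂, -, h2, h2'⟩ := fib_struct hu hL hc y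
  obtain ⟨c₃, p₃, -, h3, h3'⟩ := fib_struct hu hL hc (a + x + y)
  have v1 := struct_vol h1 h1'
  have v2 := struct_vol h2 h2'
  have v3 := struct_vol h3 h3'
  have v4 : volume (fib u L (a - (inner ℝ u a : ℝ) • u + x + y)) = ENNReal.ofReal (2 * p₃) := by
    rw [← v3, ← fib_shift u L (a + x + y) (-inner ℝ u a)]
    congr 2
    rw [neg_smul]; abel
  simp only
  rw [fib_St hu v1, fib_St hu v2, fib_St hu v4]
  apply riesz1 (struct_ae h1 h1') (struct_ae h2 h2') (struct_ae h3 h3') (ball_ae _ _)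
    (ball_ae _ _) (ball_ae _ _)
  simp only [inner_add_right, inner_sub_right, inner_smul_right, real_inner_self_eq_norm_sq, hu]
  ring

lemma F_mono {L M : Set E} (h : L ⊆ M) (a : E) : F L a ≤ F M a := by
  have : ∀ x, ind L x ≤ ind M x := fun x =>
    Set.indicator_le_indicator_of_subset h (fun _ => zero_le) x
  unfold F
  gcongr <;> apply this

lemma F_ball (r : ℝ) (a : E) : F (Metric.closedBall (0:E) r) a ≤ F (Metric.closedBall (0:E) r) 0 := by
  by_cases ha : a = 0
  · rw [ha]
  have hn : ‖a‖ ≠ 0 := norm_ne_zero_iff.2 ha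
  have hu : ‖(‖a‖⁻¹ • a)‖ = 1 := by
    rw [norm_smul, norm_inv, norm_norm, inv_mul_cancel₀ hn]
  have h := F_le_St hu (subset_refl (Metric.closedBall (0:E) r)) (convex_closedBall _ _)
    Metric.isClosed_closedBall.measurableSet a
  refine h.trans ?_
  have : a - (inner ℝ (‖a‖⁻¹ • a) a : ℝ) • (‖a‖⁻¹ • a) = 0 := by
    rw [real_inner_smul_left, real_inner_self_eq_norm_sq, smul_smul,
      show ‖a‖⁻¹ * ‖a‖ ^ 2 * ‖a‖⁻¹ = 1 by field_simp, one_smul, sub_self]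
  rw [this]
  exact F_mono (St_subset hu (subset_refl _)) 0

lemma gain_dir {u : E} (hu : ‖u‖ = 1) {L : Set E} {R r : ℝ} (hL : L ⊆ Metric.closedBall 0 R)
    (hc : Convex ℝ L) (hm : MeasurableSet L) (b : ℝ) :
    volume (L ∩ Metric.closedBall 0 r) + volume {z | z ∈ L \ Metric.closedBall 0 r ∧
      z + b • u ∈ Metric.closedBall 0 r \ L} ≤ volume (St u L ∩ Metric.closedBall 0 r) := by
  set B := Metric.closedBall (0:E) r with hB
  have hBm : MeasurableSet B := Metric.isClosed_closedBall.measurableSet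
  set D := {z | z ∈ L \ B ∧ z + b • u ∈ B \ L} with hD
  have hDm : MeasurableSet D := by
    apply (hm.diff hBm).inter
    apply (hBm.diff hm).preimage
    fun_prop
  rw [vol_disint hu (hm.inter hBm), vol_disint hu hDm,
    vol_disint hu ((St_meas u hm).inter hBm), ← lintegral_add_left (vol_fib_meas u (hm.inter hBm))]
  apply lintegral_mono
  intro x
  simp only
  have hle1 : volume (fib u (L ∩ B) x) + volume (fib u D x) ≤ volume (fib u L x) := by
    rw [← measure_union]
    · apply measure_mono
      rintro t (ht | ht)
      · exact ht.1
      · exact ht.1.1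
    · rw [Set.disjoint_left]
      intro t ht ht'
      exact ht'.1.2 ht.2
    · exact fib_meas u hDm x
  have hle2 : volume (fib u (L ∩ B) x) + volume (fib u D x) ≤ volume (fib u B x) := by
    have h1 : volume (fib u D x) ≤ volume (fib u (B \ L) x) := by
      rw [← measure_preimage_add_right volume (-b) (fib u D x)]
      apply measure_mono
      intro t ht
      have := ht.2
      simp only [fib, Set.mem_ofPred_eq]
      convert this using 1
      module
    refine (add_le_add_right h1 _).trans ?_
    rw [← measure_union]
    · apply measure_mono
      rintro t (ht | ht)
      · exact ht.2
      · exact ht.1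
    · rw [Set.disjoint_left]
      intro t ht ht'
      exact ht'.2 ht.1
    · exact fib_meas u (hBm.diff hm) x
  obtain ⟨c, p, hp, h1, h2⟩ := fib_struct hu hL hc x
  have hv := struct_vol h1 h2
  have hS := fib_St hu hv
  have hi : fib u (St u L ∩ B) x = fib u (St u L) x ∩ fib u B x := rfl
  by_cases hsub : fib u (St u L) x ⊆ fib u B x
  · rw [hi, Set.inter_eq_left.2 hsub, vol_fib_St hu hL hc]
    exact hle1
  · have : fib u B x ⊆ fib u (St u L) x := by
      obtain ⟨t, ht, htB⟩ := Set.not_subset.1 hsub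
      intro t' ht'
      rw [hS, Metric.mem_ball, Real.dist_eq, sub_neg_eq_add] at ht ⊢
      refine lt_of_le_of_lt ?_ ht
      apply sq_le_sq.1
      simp only [fib, Set.mem_ofPred_eq, hB, mem_closedBall_zero_iff, not_le] at htB ht'
      have h3 : ‖x + t' • u‖ ^ 2 ≤ ‖x + t • u‖ ^ 2 := by
        have := ht'.trans htB.le
        gcongr
      rw [normsq hu, normsq hu] at h3
      linarith
    rw [hi, Set.inter_eq_right.2 this]
    exact hle2

lemma exists_shift {P Q : Set E} {R : ℝ} (hP : P ⊆ Metric.closedBall 0 R)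
    (hQ : Q ⊆ Metric.closedBall 0 R) (hPm : MeasurableSet P) (hQm : MeasurableSet Q)
    {c : ℝ≥0∞} (hc : c * volume (Metric.closedBall (0:E) (2 * R)) < volume P * volume Q) :
    ∃ w : E, c ≤ volume {z | z ∈ P ∧ z + w ∈ Q} := by
  by_contra! hcon
  apply absurd hc
  rw [not_lt]
  have iP := ind_meas hPm
  have iQ := ind_meas hQm
  have hDm : ∀ w : E, MeasurableSet {z | z ∈ P ∧ z + w ∈ Q} := by
    intro w
    apply hPm.inter
    apply hQm.preimage
    fun_prop
  have e1 : ∀ w : E, volume {z | z ∈ P ∧ z + w ∈ Q} = ∫⁻ z, ind P z * ind Q (z + w) := by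
    intro w
    rw [← lintegral_indicator_one (hDm w)]
    apply lintegral_congr
    intro z
    unfold ind
    by_cases h1 : z ∈ P <;> by_cases h2 : z + w ∈ Q <;> simp [h1, h2]
  calc volume P * volume Q = ∫⁻ z, ∫⁻ w, ind P z * ind Q (z + w) := by
        have : ∀ z, ∫⁻ w, ind P z * ind Q (z + w) = ind P z * volume Q := by
          intro z
          rw [lintegral_const_mul _ (by fun_prop), lintegral_add_left_eq_self (ind Q) z,
            lintegral_indicator_one hQm]
        simp_rw [this]
        rw [lintegral_mul_const _ iP, lintegral_indicator_one hPm]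
    _ = ∫⁻ w, volume {z | z ∈ P ∧ z + w ∈ Q} := by
        rw [lintegral_lintegral_swap]
        · simp_rw [e1]
        · apply Measurable.aemeasurable
          unfold Function.uncurry
          fun_prop
    _ ≤ ∫⁻ w, (Metric.closedBall (0:E) (2 * R)).indicator (fun _ => c) w := by
        apply lintegral_mono
        intro w
        by_cases hw : w ∈ Metric.closedBall (0:E) (2 * R)
        · rw [Set.indicator_of_mem hw]
          exact (hcon w).le
        · have : {z | z ∈ P ∧ z + w ∈ Q} = ∅ := by
            rw [Set.eq_empty_iff_forall_notMem]
            rintro z ⟨hz, hzw⟩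
            apply hw
            have k1 := hP hz
            have k2 := hQ hzw
            rw [mem_closedBall_zero_iff] at *
            have := norm_sub_le (z + w) z
            rw [add_sub_cancel_left] at this
            linarith
          simp only [this, measure_empty, zero_le]
    _ = c * volume (Metric.closedBall (0:E) (2 * R)) := by
        rw [lintegral_indicator Metric.isClosed_closedBall.measurableSet]
        simp

/-- the class of sets reachable -/
structure Good (K : Set E) (a : E) (R : ℝ) (L : Set E) : Prop where
  sub : L ⊆ Metric.closedBall 0 R
  conv : Convex ℝ L
  meas : MeasurableSet L
  vol : volume L = 1
  le : ∃ a', F K a ≤ F L a'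

lemma vol_diff_eq {L B : Set E} (hL : MeasurableSet L) (hB : MeasurableSet B)
    (h1 : volume L = 1) (h2 : volume B = 1) : volume (B \ L) = volume (L \ B) := by
  have f1 : volume (L ∩ B) ≠ ∞ := measure_ne_top_of_subset Set.inter_subset_left (by simp [h1])
  have k1 := measure_inter_add_sdiff (μ := volume) L hB
  have k2 := measure_inter_add_sdiff (μ := volume) B hL
  rw [Set.inter_comm] at k2
  rw [h2, ← h1, ← k1] at k2
  exact (ENNReal.add_right_inj f1).1 k2

lemma exists_close {K : Set E} {a : E} {R r : ℝ} (hK : Good K a R K)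
    (hr : Metric.closedBall (0:E) r ⊆ Metric.closedBall 0 R)
    (hB : volume (Metric.closedBall (0:E) r) = 1) {δ : ℝ≥0∞} (hδ : 0 < δ) :
    ∃ L, Good K a R L ∧ volume (L \ Metric.closedBall 0 r) ≤ δ := by
  by_contra! hcon
  set B := Metric.closedBall (0:E) r with hBdef
  have hBm : MeasurableSet B := Metric.isClosed_closedBall.measurableSet
  obtain ⟨c, hc0, hc⟩ := ENNReal.exists_nnreal_pos_mul_lt
    (a := volume (Metric.closedBall (0:E) (2 * R))) (b := δ * δ)
    (isCompact_closedBall _ _).measure_ne_top (mul_ne_zero hδ.ne' hδ.ne')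
  have step : ∀ L, Good K a R L → ∃ L', Good K a R L' ∧
      volume (L ∩ B) + c ≤ volume (L' ∩ B) := by
    intro L hL
    have hd := hcon L hL
    have hd2 := vol_diff_eq hL.meas hBm hL.vol hB
    obtain ⟨w, hw⟩ := exists_shift (P := L \ B) (Q := B \ L) (R := R) (c := c)
      (Set.sdiff_subset.trans hL.sub) (Set.sdiff_subset.trans hr) (hL.meas.diff hBm)
      (hBm.diff hL.meas) (hc.trans_le (by rw [hd2]; gcongr))
    have hw0 : w ≠ 0 := by
      rintro rfl
      have : {z | z ∈ L \ B ∧ z + 0 ∈ B \ L} = ∅ := by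
        rw [Set.eq_empty_iff_forall_notMem]
        rintro z ⟨hz, hz'⟩
        rw [add_zero] at hz'
        exact hz.2 hz'.1
      rw [this, measure_empty] at hw
      simp at hw
      exact hc0.ne' hw
    have hn : ‖w‖ ≠ 0 := norm_ne_zero_iff.2 hw0
    have hu : ‖(‖w‖⁻¹ • w)‖ = 1 := by
      rw [norm_smul, norm_inv, norm_norm, inv_mul_cancel₀ hn]
    refine ⟨St (‖w‖⁻¹ • w) L, ⟨St_subset hu hL.sub, St_convex hu hL.sub hL.conv,
      St_meas _ hL.meas, ?_, ?_⟩, ?_⟩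
    · rw [vol_St hu hL.sub hL.conv hL.meas, hL.vol]
    · obtain ⟨a', ha'⟩ := hL.le
      exact ⟨_, ha'.trans (F_le_St hu hL.sub hL.conv hL.meas a')⟩
    · refine le_trans ?_ (gain_dir hu hL.sub hL.conv hL.meas ‖w‖)
      rw [smul_smul, mul_inv_cancel₀ hn, one_smul]
      gcongr
  have iter : ∀ n : ℕ, ∃ L, Good K a R L ∧ n * (c : ℝ≥0∞) ≤ volume (L ∩ B) := by
    intro n
    induction n with
    | zero => exact ⟨K, hK, by simp⟩
    | succ n ih =>
      obtain ⟨L, hL, h⟩ := ih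
      obtain ⟨L', hL', h'⟩ := step L hL
      refine ⟨L', hL', le_trans ?_ h'⟩
      push_cast
      rw [add_mul, one_mul]
      gcongr
  obtain ⟨n, hn⟩ := ENNReal.exists_nat_mul_gt (a := (c : ℝ≥0∞)) (b := 1)
    (by exact_mod_cast hc0.ne') ENNReal.one_ne_top
  obtain ⟨L, hL, h⟩ := iter n
  have : volume (L ∩ B) ≤ 1 := (measure_mono Set.inter_subset_left).trans hL.vol.le
  exact absurd (hn.trans_le (h.trans this)) (lt_irrefl _)

lemma F_close {L B : Set E} (hL : MeasurableSet L) (hB : MeasurableSet B) (h1 : volume L = 1)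
    (a : E) : F L a ≤ F B a + 3 * volume (L \ B) := by
  have iL := ind_meas hL
  have iB := ind_meas hB
  have iP := ind_meas (hL.diff hB)
  have vL : ∫⁻ x, ind L x = 1 := by rw [lintegral_indicator_one hL, h1]
  have vP : ∫⁻ x, ind (L \ B) x = volume (L \ B) := lintegral_indicator_one (hL.diff hB)
  have key : ∀ x y, ind L x * ind L y * ind L (a + x + y) ≤
      ind B x * ind B y * ind B (a + x + y) + (ind (L \ B) x * ind L y + (ind L x * ind (L \ B) y
        + ind L x * ind (L \ B) (a + x + y))) := by
    intro x y
    unfold ind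
    by_cases k1 : x ∈ L <;> by_cases k2 : y ∈ L <;> by_cases k3 : a + x + y ∈ L <;>
    by_cases k4 : x ∈ B <;> by_cases k5 : y ∈ B <;> by_cases k6 : a + x + y ∈ B <;>
      simp [k1, k2, k3, k4, k5, k6]
  calc F L a ≤ ∫⁻ x, ∫⁻ y, (ind B x * ind B y * ind B (a + x + y) +
        (ind (L \ B) x * ind L y + (ind L x * ind (L \ B) y
        + ind L x * ind (L \ B) (a + x + y)))) := by
        unfold F
        gcongr with x y
        exact key x y
    _ = ∫⁻ x, ((∫⁻ y, ind B x * ind B y * ind B (a + x + y)) + (ind (L \ B) x +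
          (ind L x * volume (L \ B) + ind L x * volume (L \ B)))) := by
        apply lintegral_congr
        intro x
        rw [lintegral_add_left (by fun_prop), lintegral_add_left (by fun_prop),
          lintegral_add_left (by fun_prop), lintegral_const_mul _ (by fun_prop),
          lintegral_const_mul _ (by fun_prop), lintegral_const_mul _ (by fun_prop),
          lintegral_add_left_eq_self (ind (L \ B)) (a + x), vL, vP, mul_one]
    _ = F B a + 3 * volume (L \ B) := by
        rw [lintegral_add_right _ (by fun_prop), lintegral_add_left (by fun_prop),
          lintegral_add_left (by fun_prop), lintegral_mul_const _ (by fun_prop), vL, vP]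
        unfold F
        ring

theorem riesz {K : Set E} {r : ℝ} (hKb : Bornology.IsBounded K) (hKm : MeasurableSet K)
    (hKc : Convex ℝ K) (hKv : volume K = 1) (hB : volume (Metric.closedBall (0:E) r) = 1) (a : E) :
    F K a ≤ F (Metric.closedBall (0:E) r) 0 := by
  obtain ⟨R₀, hR₀⟩ := hKb.subset_closedBall 0
  have hK : Good K a (max R₀ r) K := ⟨hR₀.trans (Metric.closedBall_subset_closedBall
    (le_max_left _ _)), hKc, hKm, hKv, a, le_rfl⟩
  apply ENNReal.le_of_forall_pos_le_add
  intro ε hε _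
  obtain ⟨L, hL, hd⟩ := exists_close hK (Metric.closedBall_subset_closedBall
    (le_max_right _ _)) hB (δ := ε / 3) (by simpa using hε.ne')
  obtain ⟨a', ha'⟩ := hL.le
  calc F K a ≤ F L a' := ha'
    _ ≤ _ := F_close hL.meas Metric.isClosed_closedBall.measurableSet hL.vol a'
    _ ≤ _ := by
      refine add_le_add (F_ball r a') ?_
      calc 3 * volume (L \ Metric.closedBall 0 r) ≤ 3 * (ε / 3 : ℝ≥0∞) := by gcongr
        _ = ε := ENNReal.mul_div_cancel (by norm_num) (by norm_num)

end Steiner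

end RieszAux

/-- Good gaps: with `G = {z : P(z + X'_K ∉ K) ≥ 1 - η}`, for any `a`,
`P(a + X_K ∉ G) ≤ η⁻¹ P(X_B + X'_B ∈ B)`. -/
theorem stmt_8 (d : ℕ) (K B : Set (EuclideanSpace ℝ (Fin d)))
    (hKc : IsCompact K) (hKconv : Convex ℝ K) (hKsym : ∀ x ∈ K, -x ∈ K)
    (hKvol : volume K = 1)
    (r : ℝ) (hB : B = Metric.closedBall 0 r) (hBvol : volume B = 1)
    (η : ℝ) (hη : 0 < η)
    (G : Set (EuclideanSpace ℝ (Fin d)))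
    (hG : G = {z | ENNReal.ofReal (1 - η) ≤ volume.restrict K {x | z + x ∉ K}})
    (a : EuclideanSpace ℝ (Fin d)) :
    volume.restrict K {x | a + x ∉ G}
      ≤ ENNReal.ofReal η⁻¹ *
        (volume.restrict B).prod (volume.restrict B) {p | p.1 + p.2 ∈ B} := by
  open RieszAux in
  have hKm : MeasurableSet K := hKc.isClosed.measurableSet
  have hBm : MeasurableSet B := by rw [hB]; exact Metric.isClosed_closedBall.measurableSet
  have iK := ind_meas hKm
  have iB := ind_meas hBm
  have hsec : ∀ (A : Set (EuclideanSpace ℝ (Fin d))), MeasurableSet A → ∀ z,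
      volume.restrict A {x | z + x ∈ A} = ∫⁻ y, ind A y * ind A (z + y) := by
    intro A hA z
    have hm : MeasurableSet {x | z + x ∈ A} := by apply hA.preimage; fun_prop
    rw [Measure.restrict_apply hm, ← lintegral_indicator_one (hm.inter hA)]
    apply lintegral_congr
    intro y
    unfold ind
    by_cases h1 : y ∈ A <;> by_cases h2 : z + y ∈ A <;> simp [h1, h2]
  have hF : ∀ (A : Set (EuclideanSpace ℝ (Fin d))), MeasurableSet A → ∀ z,
      F A z = ∫⁻ x in A, volume.restrict A {y | z + x + y ∈ A} := by
    intro A hA z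
    have iA := ind_meas hA
    unfold F
    rw [← lintegral_indicator hA]
    apply lintegral_congr
    intro x
    simp_rw [mul_assoc]
    rw [lintegral_const_mul _ (by fun_prop), ← hsec A hA (z + x)]
    unfold ind
    by_cases h : x ∈ A <;> simp [h]
  have hR : (volume.restrict B).prod (volume.restrict B) {p | p.1 + p.2 ∈ B} = F B 0 := by
    rw [Measure.prod_apply (by apply hBm.preimage; fun_prop), hF B hBm]
    simp only [zero_add]
    rfl
  have hmain : F K a ≤ F B 0 := by
    subst hB
    exact riesz hKc.isBounded hKm hKconv hKvol hBvol a
  have hsub : {x | a + x ∉ G} ⊆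
      {x | ENNReal.ofReal η ≤ volume.restrict K {y | a + x + y ∈ K}} := by
    intro x hx
    rw [Set.mem_ofPred_eq, hG, Set.mem_ofPred_eq, not_le] at hx
    rw [Set.mem_ofPred_eq]
    by_contra! hlt
    have hm : MeasurableSet {y | a + x + y ∈ K} := by apply hKm.preimage; fun_prop
    have hadd := measure_add_measure_compl (μ := volume.restrict K) hm
    rw [Measure.restrict_apply_univ, hKvol] at hadd
    have hx' : volume.restrict K {y | a + x + y ∈ K}ᶜ < ENNReal.ofReal (1 - η) := hx
    have hη1 : 0 < 1 - η := by
      by_contra! h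
      rw [ENNReal.ofReal_of_nonpos h] at hx'
      exact absurd hx' (by simp)
    have := ENNReal.add_lt_add hlt hx'
    rw [hadd, ← ENNReal.ofReal_add hη.le hη1.le] at this
    simp at this
  have hgm : Measurable fun x => volume.restrict K {y | a + x + y ∈ K} := by
    simp_rw [hsec K hKm]
    apply Measurable.lintegral_prod_right
    unfold Function.uncurry
    fun_prop
  rw [hR]
  have hmk := mul_meas_ge_le_lintegral (μ := volume.restrict K) hgm (ENNReal.ofReal η)
  rw [← hF K hKm a] at hmk
  calc volume.restrict K {x | a + x ∉ G}
      ≤ volume.restrict K {x | ENNReal.ofReal η ≤ volume.restrict K {y | a + x + y ∈ K}} :=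
        measure_mono hsub
    _ = ENNReal.ofReal η⁻¹ * (ENNReal.ofReal η *
        volume.restrict K {x | ENNReal.ofReal η ≤ volume.restrict K {y | a + x + y ∈ K}}) := by
        rw [← mul_assoc, ← ENNReal.ofReal_mul (by positivity), inv_mul_cancel₀ hη.ne']
        simp
    _ ≤ ENNReal.ofReal η⁻¹ * F B 0 := by
        gcongr
        exact hmk.trans hmain
end

section
/- Let K ⊂ ℝ^d be compact, convex, symmetric, with |K| = 1, and let ‖x‖_K = inf{r > 0 : x ∈ rK} be the associated norm. If X_K, X'_K are i.i.d. uniform on K and X_B, X'_B are i.i.d. uniform on the centered Euclidean ball B of volume 1, then for every r > 0, P(‖X_K + X'_K‖_K ≤ r) ≤ P(‖X_B + X'_B‖₂·(volume-1 normalization) ≤ r), i.e. P(X_K + X'_K ∈ rK) ≤ P(X_B + X'_B ∈ rB). -/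
open MeasureTheory Pointwise

namespace RRI

/-- Bathtub comparison. -/
lemma bathtub (D D' : Set ℝ) (hD : MeasurableSet D) (hD' : MeasurableSet D')
    (hv : volume D = volume D') (hfin : volume D ≠ ⊤) (g : ℝ → ENNReal) (m : ENNReal)
    (h1 : ∀ z ∈ D', m ≤ g z) (h2 : ∀ z, z ∉ D' → g z ≤ m) :
    ∫⁻ z in D, g z ≤ ∫⁻ z in D', g z := by
  have e1 : volume (D \ D') = volume (D' \ D) := by
    have a1 := measure_inter_add_sdiff D hD' (μ := volume)
    have a2 := measure_inter_add_sdiff D' hD (μ := volume)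
    rw [Set.inter_comm] at a2
    rw [← hv, ← a1] at a2
    have hi : volume (D ∩ D') ≠ ⊤ := ne_top_of_le_ne_top hfin (measure_mono Set.inter_subset_left)
    exact ((ENNReal.add_right_inj hi).1 a2).symm
  rw [← lintegral_inter_add_sdiff g D hD', ← lintegral_inter_add_sdiff g D' hD, Set.inter_comm D' D]
  gcongr 1
  calc ∫⁻ z in D \ D', g z ≤ ∫⁻ z in D \ D', m :=
        setLIntegral_mono measurable_const (fun z hz => h2 z hz.2)
    _ = ∫⁻ z in D' \ D, m := by simp [e1]
    _ ≤ ∫⁻ z in D' \ D, g z := setLIntegral_mono' (hD'.diff hD) (fun z hz => h1 z hz.1)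

/-- The planar set of the one-dimensional problem. -/
def tri (I J L : Set ℝ) : Set (ℝ × ℝ) := {p | p.1 ∈ I ∧ p.2 ∈ J ∧ p.1 + p.2 ∈ L}

lemma tri_vol (a₁ b₁ a₂ b₂ a₃ b₃ : ℝ) :
    volume (tri (Set.Icc a₁ b₁) (Set.Icc a₂ b₂) (Set.Icc a₃ b₃)) =
      ∫⁻ z in Set.Icc a₃ b₃, ENNReal.ofReal (min b₁ (z - a₂) - max a₁ (z - b₂)) := by
  have hm : MeasurePreserving (fun z : ℝ × ℝ => (z.2, z.1 - z.2)) volume volume := by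
    have h1 : MeasurePreserving (fun z : ℝ × ℝ => (z.1, -z.1 + z.2)) volume volume :=
      measurePreserving_prod_neg_add volume volume
    have h2 : MeasurePreserving (Prod.swap : ℝ × ℝ → ℝ × ℝ) volume volume :=
      Measure.measurePreserving_swap
    convert h1.comp h2 using 2
    simp; ring
  have hmeas : MeasurableSet (tri (Set.Icc a₁ b₁) (Set.Icc a₂ b₂) (Set.Icc a₃ b₃)) :=
    (measurable_fst measurableSet_Icc).inter ((measurable_snd measurableSet_Icc).inter
      ((measurable_fst.add measurable_snd) measurableSet_Icc))
  rw [← hm.measure_preimage hmeas.nullMeasurableSet, Measure.volume_eq_prod,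
    Measure.prod_apply (hm.measurable hmeas), ← lintegral_indicator measurableSet_Icc]
  congr 1
  ext z
  by_cases hz : z ∈ Set.Icc a₃ b₃
  · rw [Set.indicator_of_mem hz, ← Real.volume_Icc]
    congr 1
    ext t
    simp [tri] at hz ⊢
    grind
  · rw [Set.indicator_of_notMem hz]
    convert measure_empty (μ := (volume : Measure ℝ))
    ext t
    simp [tri] at hz ⊢
    grind

lemma one_dim (a₁ b₁ a₂ b₂ a₃ b₃ : ℝ) :
    volume (tri (Set.Icc a₁ b₁) (Set.Icc a₂ b₂) (Set.Icc a₃ b₃)) ≤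
    volume (tri (Set.Icc (-((b₁ - a₁) / 2)) ((b₁ - a₁) / 2))
      (Set.Icc (-((b₂ - a₂) / 2)) ((b₂ - a₂) / 2)) (Set.Icc (-((b₃ - a₃) / 2)) ((b₃ - a₃) / 2))) := by
  set i := (b₁ - a₁) / 2 with hi
  set j := (b₂ - a₂) / 2 with hj
  set l := (b₃ - a₃) / 2 with hl
  set c := (a₁ + b₁) / 2 + (a₂ + b₂) / 2 with hc
  rw [tri_vol, tri_vol]
  by_cases hl0 : 0 ≤ l
  swap
  · rw [Set.Icc_eq_empty (a := a₃) (by intro h; apply hl0; linarith)]; simp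
  set g : ℝ → ENNReal := fun z => ENNReal.ofReal (min i (z + j) - max (-i) (z - j)) with hg
  have e1 : ∫⁻ z in Set.Icc a₃ b₃, ENNReal.ofReal (min b₁ (z - a₂) - max a₁ (z - b₂)) =
      ∫⁻ z in Set.Icc (a₃ - c) (b₃ - c), g z := by
    rw [← lintegral_indicator measurableSet_Icc, ← lintegral_indicator measurableSet_Icc,
      ← lintegral_sub_right_eq_self ((Set.Icc (a₃ - c) (b₃ - c)).indicator g) c]
    congr 1
    ext z
    have hmem : z ∈ Set.Icc a₃ b₃ ↔ z - c ∈ Set.Icc (a₃ - c) (b₃ - c) := by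
      simp
    by_cases hz : z ∈ Set.Icc a₃ b₃
    · rw [Set.indicator_of_mem hz, Set.indicator_of_mem (hmem.1 hz)]
      simp only [hg]
      congr 1
      have : min i (z - c + j) = min b₁ (z - a₂) - (a₁ + b₁) / 2 := by
        rw [← min_sub_sub_right]; congr 1 <;> linarith
      have : max (-i) (z - c - j) = max a₁ (z - b₂) - (a₁ + b₁) / 2 := by
        rw [← max_sub_sub_right]; congr 1 <;> linarith
      linarith
    · rw [Set.indicator_of_notMem hz, Set.indicator_of_notMem (fun h => hz (hmem.2 h))]
  have e2 : ∫⁻ z in Set.Icc (-l) l, ENNReal.ofReal (min i (z - -j) - max (-i) (z - j)) =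
      ∫⁻ z in Set.Icc (-l) l, g z := by simp [hg]
  rw [e1, e2]
  refine bathtub _ _ measurableSet_Icc measurableSet_Icc ?_ (by simp) g (g l) ?_ ?_
  · simp only [Real.volume_Icc]; congr 1; linarith
  · rintro z ⟨hz1, hz2⟩
    apply ENNReal.ofReal_le_ofReal
    rcases min_cases i (z + j) with h | h <;> rcases max_cases (-i) (z - j) with h' | h' <;>
      rcases min_cases i (l + j) with hcc | hcc <;> rcases max_cases (-i) (l - j) with hd | hd <;>
      linarith
  · intro z hz
    apply ENNReal.ofReal_le_ofReal
    have hz' : z < -l ∨ l < z := by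
      simp only [Set.mem_Icc, not_and_or, not_le] at hz; exact hz
    rcases hz' with hz' | hz' <;>
    rcases min_cases i (z + j) with h | h <;> rcases max_cases (-i) (z - j) with h' | h' <;>
    rcases min_cases i (l + j) with hcc | hcc <;> rcases max_cases (-i) (l - j) with hd | hd <;>
    linarith
end RRI
namespace RRI

/-- Euclidean space of dimension `n + 1`. -/
abbrev E (n : ℕ) := EuclideanSpace ℝ (Fin (n + 1))

/-- The point with first coordinate `t` and other coordinates `y`. -/
def mk {n : ℕ} (y : Fin n → ℝ) (t : ℝ) : E n := WithLp.toLp 2 (Fin.cons t y)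

/-- The other coordinates. -/
def tl {n : ℕ} (x : E n) : Fin n → ℝ := fun i => x i.succ

variable {n : ℕ}

@[simp] lemma mk_zero (y : Fin n → ℝ) (t : ℝ) : mk y t 0 = t := by simp [mk]
@[simp] lemma mk_succ (y : Fin n → ℝ) (t : ℝ) (i : Fin n) : mk y t i.succ = y i := by simp [mk]
@[simp] lemma tl_mk (y : Fin n → ℝ) (t : ℝ) : tl (mk y t) = y := by ext; simp [tl]
@[simp] lemma mk_tl (x : E n) : mk (tl x) (x 0) = x := by
  ext i; refine Fin.cases ?_ ?_ i <;> simp [tl]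

lemma mk_comb (a b : ℝ) (y y' : Fin n → ℝ) (t t' : ℝ) :
    a • mk y t + b • mk y' t' = mk (a • y + b • y') (a * t + b * t') := by
  ext i; refine Fin.cases ?_ ?_ i <;> simp

lemma smul_mk (a : ℝ) (y : Fin n → ℝ) (t : ℝ) : a • mk y t = mk (a • y) (a * t) := by
  ext i; refine Fin.cases ?_ ?_ i <;> simp

lemma mk_add (y y' : Fin n → ℝ) (t t' : ℝ) : mk y t + mk y' t' = mk (y + y') (t + t') := by
  ext i; refine Fin.cases ?_ ?_ i <;> simp

lemma neg_mk (y : Fin n → ℝ) (t : ℝ) : -mk y t = mk (-y) (-t) := by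
  ext i; refine Fin.cases ?_ ?_ i <;> simp

lemma norm_mk (y : Fin n → ℝ) (t : ℝ) : ‖mk y t‖ ^ 2 = t ^ 2 + ∑ i, y i ^ 2 := by
  rw [EuclideanSpace.norm_sq_eq, Fin.sum_univ_succ]; simp

lemma continuous_mk : Continuous (fun p : (Fin n → ℝ) × ℝ => mk p.1 p.2) := by
  unfold mk
  refine (PiLp.continuous_toLp 2 _).comp ?_
  refine continuous_pi fun i => ?_
  refine Fin.cases ?_ (fun i => ?_) i
  · simpa using continuous_snd
  · simp only [Fin.cons_succ]; fun_prop

lemma continuous_tl : Continuous (tl : E n → Fin n → ℝ) := by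
  unfold tl; fun_prop

lemma mp_mk : MeasurePreserving (fun p : (Fin n → ℝ) × ℝ => mk p.1 p.2) volume volume := by
  have h1 := (volume_preserving_piFinSuccAbove (fun _ : Fin (n + 1) => ℝ) 0).symm
  have h2 : MeasurePreserving (Prod.swap : (Fin n → ℝ) × ℝ → ℝ × (Fin n → ℝ)) volume volume :=
    Measure.measurePreserving_swap
  have h3 := (PiLp.volume_preserving_toLp (Fin (n + 1))).comp (h1.comp h2)
  have he : (fun p : (Fin n → ℝ) × ℝ => mk p.1 p.2) = (WithLp.toLp 2 ∘
      ⇑(MeasurableEquiv.piFinSuccAbove (fun _ : Fin (n + 1) => ℝ) 0).symm ∘ Prod.swap) := by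
    funext p
    simp [mk, MeasurableEquiv.piFinSuccAbove]
    rfl
  rw [he]
  exact h3

/-- Slice of a set. -/
def sl (L : Set (E n)) (y : Fin n → ℝ) : Set ℝ := {t | mk y t ∈ L}

/-- Steiner symmetral of a convex set in the first coordinate direction. -/
def St (L : Set (E n)) : Set (E n) :=
  {z | ∃ y a b, mk y a ∈ L ∧ mk y b ∈ L ∧ z = mk y ((a - b) / 2)}

lemma St_compact {L : Set (E n)} (hL : IsCompact L) : IsCompact (St L) := by
  have h1 : IsCompact ((L ×ˢ L) ∩ {p | tl p.1 = tl p.2}) :=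
    (hL.prod hL).inter_right (isClosed_eq (continuous_tl.comp continuous_fst)
      (continuous_tl.comp continuous_snd))
  have h2 : Continuous (fun p : E n × E n => mk (tl p.1) ((p.1 0 - p.2 0) / 2)) := by
    refine continuous_mk.comp (Continuous.prodMk (continuous_tl.comp continuous_fst) ?_)
    fun_prop
  convert h1.image h2
  ext z
  constructor
  · rintro ⟨y, a, b, ha, hb, rfl⟩
    exact ⟨(mk y a, mk y b), ⟨⟨ha, hb⟩, by simp⟩, by simp⟩
  · rintro ⟨⟨p, q⟩, ⟨⟨hp, hq⟩, hpq⟩, rfl⟩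
    simp only [Set.mem_ofPred_eq] at hpq hp hq
    refine ⟨tl p, p 0, q 0, by simpa, by rw [hpq]; simpa, rfl⟩

lemma St_convex {L : Set (E n)} (hL : Convex ℝ L) : Convex ℝ (St L) := by
  rintro _ ⟨y, a, b, ha, hb, rfl⟩ _ ⟨y', a', b', ha', hb', rfl⟩ s t hs ht hst
  refine ⟨s • y + t • y', s * a + t * a', s * b + t * b', ?_, ?_, ?_⟩
  · rw [← mk_comb]; exact hL ha ha' hs ht hst
  · rw [← mk_comb]; exact hL hb hb' hs ht hst
  · rw [mk_comb]; congr 1; ring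

lemma St_symm {L : Set (E n)} (hL : ∀ x ∈ L, -x ∈ L) : ∀ x ∈ St L, -x ∈ St L := by
  rintro _ ⟨y, a, b, ha, hb, rfl⟩
  refine ⟨-y, -a, -b, ?_, ?_, ?_⟩
  · rw [← neg_mk]; exact hL _ ha
  · rw [← neg_mk]; exact hL _ hb
  · rw [neg_mk]; congr 1; ring

lemma St_ball {L : Set (E n)} {R : ℝ} (hL : L ⊆ Metric.closedBall 0 R) :
    St L ⊆ Metric.closedBall 0 R := by
  rintro _ ⟨y, a, b, ha, hb, rfl⟩
  have h1 := hL ha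
  have h2 := hL hb
  rw [mem_closedBall_zero_iff] at *
  have hR : 0 ≤ R := (norm_nonneg _).trans h1
  refine abs_le_of_sq_le_sq' ?_ hR |>.2
  have h1' : ‖mk y a‖ ^ 2 ≤ R ^ 2 := by gcongr
  have h2' : ‖mk y b‖ ^ 2 ≤ R ^ 2 := by gcongr
  rw [norm_mk] at *
  nlinarith [sq_nonneg (a + b)]

lemma St_smul {L : Set (E n)} (r : ℝ) (hr : 0 < r) : St (r • L) = r • St L := by
  ext z
  constructor
  · rintro ⟨y, a, b, ha, hb, rfl⟩
    rw [Set.mem_smul_set_iff_inv_smul_mem₀ hr.ne', smul_mk] at *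
    exact ⟨_, _, _, ha, hb, by congr 1; ring⟩
  · rintro ⟨_, ⟨y, a, b, ha, hb, rfl⟩, rfl⟩
    refine ⟨r • y, r * a, r * b, ?_, ?_, ?_⟩
    · rw [← smul_mk]; exact Set.smul_mem_smul_set ha
    · rw [← smul_mk]; exact Set.smul_mem_smul_set hb
    · simp only [smul_mk]; congr 1; ring

lemma sl_Icc {L : Set (E n)} (hc : IsCompact L) (hL : Convex ℝ L) (y : Fin n → ℝ) :
    ∃ a b, sl L y = Set.Icc a b := by
  have hcont : Continuous (fun t : ℝ => mk y t) :=
    continuous_mk.comp (Continuous.prodMk (continuous_const (y := y)) continuous_id)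
  rcases (sl L y).eq_empty_or_nonempty with h | h
  · exact ⟨1, 0, by rw [h]; simp⟩
  have hclosed : IsClosed (sl L y) := hc.isClosed.preimage hcont
  obtain ⟨R, hR⟩ := hc.isBounded.subset_closedBall 0
  have hcpt : IsCompact (sl L y) := by
    refine (isCompact_Icc (a := -R) (b := R)).of_isClosed_subset hclosed fun t ht => ?_
    have h1 := hR ht
    rw [mem_closedBall_zero_iff] at h1
    rw [Set.mem_Icc, ← abs_le]
    refine le_trans ?_ h1
    refine abs_le_of_sq_le_sq ?_ (norm_nonneg _)
    rw [norm_mk]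
    have := Finset.sum_nonneg (s := Finset.univ) (fun i _ => sq_nonneg (y i))
    linarith
  have hconv : Convex ℝ (sl L y) := by
    intro a ha b hb s t hs ht hst
    have h1 := hL ha hb hs ht hst
    rw [mk_comb, ← add_smul, hst, one_smul] at h1
    exact h1
  exact ⟨_, _, eq_Icc_of_connected_compact ⟨h, hconv.isPreconnected⟩ hcpt⟩

lemma sl_St {L : Set (E n)} {y : Fin n → ℝ} {a b : ℝ} (h : sl L y = Set.Icc a b) :
    sl (St L) y = Set.Icc (-((b - a) / 2)) ((b - a) / 2) := by
  have hm : ∀ t, mk y t ∈ L ↔ a ≤ t ∧ t ≤ b := fun t => by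
    rw [← Set.mem_Icc, ← h]; rfl
  ext t
  constructor
  · rintro ⟨y', s, u, hs, hu, he⟩
    have h1 := congrArg tl he
    have h2 := congrArg (fun x : E n => x 0) he
    simp at h1 h2
    subst h1
    rw [hm] at hs hu
    constructor <;> linarith
  · rintro ⟨h1, h2⟩
    refine ⟨y, (a + b) / 2 + t, (a + b) / 2 - t, ?_, ?_, ?_⟩
    · rw [hm]; constructor <;> linarith
    · rw [hm]; constructor <;> linarith
    · congr 1; ring

lemma vol_sl {L : Set (E n)} (hL : MeasurableSet L) : volume L = ∫⁻ y, volume (sl L y) := by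
  rw [← mp_mk.measure_preimage hL.nullMeasurableSet, Measure.volume_eq_prod,
    Measure.prod_apply (mp_mk.measurable hL)]
  rfl

lemma St_vol {L : Set (E n)} (hc : IsCompact L) (hL : Convex ℝ L) : volume (St L) = volume L := by
  rw [vol_sl hc.measurableSet, vol_sl (St_compact hc).measurableSet]
  congr 1
  ext y
  obtain ⟨a, b, h⟩ := sl_Icc hc hL y
  rw [h, sl_St h, Real.volume_Icc, Real.volume_Icc]
  congr 1; ring

/-- The functional. -/
def W (r : ℝ) (L : Set (E n)) : Set (E n × E n) := {p | p.1 ∈ L ∧ p.2 ∈ L ∧ p.1 + p.2 ∈ r • L}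

lemma W_closed {r : ℝ} {L : Set (E n)} (hL : IsCompact L) : IsClosed (W r L) :=
  (hL.isClosed.preimage continuous_fst).inter ((hL.isClosed.preimage continuous_snd).inter
    ((hL.smul r).isClosed.preimage (continuous_fst.add continuous_snd)))

lemma mp_comm {α β γ δ : Type*} [MeasureSpace α] [MeasureSpace β] [MeasureSpace γ] [MeasureSpace δ]
    [SigmaFinite (volume : Measure α)] [SigmaFinite (volume : Measure β)]
    [SigmaFinite (volume : Measure γ)] [SigmaFinite (volume : Measure δ)] :
    MeasurePreserving (fun p : (α × β) × (γ × δ) => ((p.1.1, p.2.1), (p.1.2, p.2.2)))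
      volume volume := by
  have h1 : MeasurePreserving (MeasurableEquiv.prodAssoc : (α × β) × (γ × δ) ≃ᵐ _) volume volume :=
    volume_preserving_prodAssoc
  have h2 : MeasurePreserving (MeasurableEquiv.prodAssoc : (β × γ) × δ ≃ᵐ _) volume volume :=
    volume_preserving_prodAssoc
  have h3 : MeasurePreserving (MeasurableEquiv.prodAssoc : (γ × β) × δ ≃ᵐ _) volume volume :=
    volume_preserving_prodAssoc
  have h4 : MeasurePreserving (MeasurableEquiv.prodAssoc : (α × γ) × (β × δ) ≃ᵐ _) volume volume :=
    volume_preserving_prodAssoc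
  have h5 : MeasurePreserving (Prod.swap : β × γ → γ × β) volume volume :=
    Measure.measurePreserving_swap
  have i1 := (MeasurePreserving.id (volume : Measure α)).prod h2.symm
  have i2 := (MeasurePreserving.id (volume : Measure α)).prod
    (h5.prod (MeasurePreserving.id (volume : Measure δ)))
  have i3 := (MeasurePreserving.id (volume : Measure α)).prod h3
  exact h4.symm.comp (i3.comp (i2.comp (i1.comp h1)))

lemma vol_W {r : ℝ} {L : Set (E n)} (hL : IsCompact L) :
    volume (W r L) = ∫⁻ p : (Fin n → ℝ) × (Fin n → ℝ),
      volume (tri (sl L p.1) (sl L p.2) (sl (r • L) (p.1 + p.2))) := by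
  have hm := (mp_mk (n := n)).prod (mp_mk (n := n))
  have hm2 := hm.comp (mp_comm (α := Fin n → ℝ) (β := Fin n → ℝ) (γ := ℝ) (δ := ℝ))
  rw [Measure.volume_eq_prod, ← hm2.measure_preimage (W_closed hL).measurableSet.nullMeasurableSet,
    Measure.volume_eq_prod, Measure.prod_apply (hm2.measurable (W_closed hL).measurableSet)]
  congr 1
  ext p
  congr 1
  ext q
  simp [W, tri, sl, mk_add]

lemma St_W {r : ℝ} (hr : 0 < r) {L : Set (E n)} (hc : IsCompact L) (hL : Convex ℝ L) :
    volume (W r L) ≤ volume (W r (St L)) := by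
  rw [vol_W hc, vol_W (St_compact hc)]
  refine lintegral_mono fun p => ?_
  obtain ⟨a₁, b₁, h₁⟩ := sl_Icc hc hL p.1
  obtain ⟨a₂, b₂, h₂⟩ := sl_Icc hc hL p.2
  obtain ⟨a₃, b₃, h₃⟩ := sl_Icc (hc.smul r) (hL.smul r) (p.1 + p.2)
  rw [← St_smul r hr, h₁, h₂, h₃, sl_St h₁, sl_St h₂, sl_St h₃]
  exact one_dim _ _ _ _ _ _

/-- Second moment. -/
noncomputable def M (L : Set (E n)) : ENNReal := ∫⁻ x in L, ENNReal.ofReal (‖x‖ ^ 2)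

lemma M_sl {L : Set (E n)} (hL : MeasurableSet L) :
    M L = ∫⁻ y : Fin n → ℝ, ∫⁻ t in sl L y, ENNReal.ofReal (t ^ 2 + ∑ i, y i ^ 2) := by
  have hme : Measurable (L.indicator (fun x => ENNReal.ofReal (‖x‖ ^ 2))) :=
    Measurable.indicator (by fun_prop) hL
  rw [M, ← lintegral_indicator hL, ← mp_mk.lintegral_comp hme, Measure.volume_eq_prod,
    lintegral_prod _ (show AEMeasurable (fun p : (Fin n → ℝ) × ℝ => L.indicator
      (fun x => ENNReal.ofReal (‖x‖ ^ 2)) (mk p.1 p.2)) _ from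
      (hme.comp mp_mk.measurable).aemeasurable)]
  congr 1
  ext y
  have hs : MeasurableSet (sl L y) :=
    (mp_mk.measurable.comp (measurable_const.prodMk measurable_id) : Measurable (fun t => mk y t)) hL
  rw [← lintegral_indicator hs]
  congr 1
  ext t
  by_cases ht : mk y t ∈ L
  · rw [Set.indicator_of_mem ht, Set.indicator_of_mem (show t ∈ sl L y from ht), norm_mk]
  · rw [Set.indicator_of_notMem ht, Set.indicator_of_notMem (show t ∉ sl L y from ht)]

lemma int_sq {a b c : ℝ} (hab : a ≤ b) (hc : 0 ≤ c) :
    ∫⁻ t in Set.Icc a b, ENNReal.ofReal (t ^ 2 + c) =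
      ENNReal.ofReal ((b ^ 3 - a ^ 3) / 3 + c * (b - a)) := by
  rw [← ofReal_integral_eq_lintegral_ofReal]
  · rw [integral_Icc_eq_integral_Ioc, ← intervalIntegral.integral_of_le hab,
      intervalIntegral.integral_add (by simp) (by simp)]
    simp; congr 1; norm_num; ring
  · exact (Continuous.continuousOn (by fun_prop)).integrableOn_Icc
  · exact Filter.Eventually.of_forall fun t => by positivity

lemma slice_ineq {a b c : ℝ} (hc : 0 ≤ c) :
    (∫⁻ t in Set.Icc (-((b - a) / 2)) ((b - a) / 2), ENNReal.ofReal (t ^ 2 + c) ≤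
      ∫⁻ t in Set.Icc a b, ENNReal.ofReal (t ^ 2 + c)) ∧
    (∫⁻ t in Set.Icc (-((b - a) / 2)) ((b - a) / 2), ENNReal.ofReal (t ^ 2 + c) =
      ∫⁻ t in Set.Icc a b, ENNReal.ofReal (t ^ 2 + c) →
      volume (Set.Icc a b \ Set.Icc (-((b - a) / 2)) ((b - a) / 2)) = 0 ∧
      volume (Set.Icc (-((b - a) / 2)) ((b - a) / 2) \ Set.Icc a b) = 0) := by
  by_cases hab : a ≤ b
  swap
  · rw [Set.Icc_eq_empty hab, Set.Icc_eq_empty (by intro h; apply hab; linarith)]; simp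
  rw [int_sq hab hc, int_sq (by linarith) hc]
  have key : (b ^ 3 - a ^ 3) / 3 + c * (b - a) =
    (((b - a) / 2) ^ 3 - (-((b - a) / 2)) ^ 3) / 3 + c * ((b - a) / 2 - -((b - a) / 2))
      + (b - a) * (b + a) ^ 2 / 4 := by ring
  have hnn : 0 ≤ (b - a) * (b + a) ^ 2 / 4 := by
    have : 0 ≤ b - a := by linarith
    positivity
  have hnn2 : 0 ≤ (((b - a) / 2) ^ 3 - (-((b - a) / 2)) ^ 3) / 3
      + c * ((b - a) / 2 - -((b - a) / 2)) := by
    have : 0 ≤ b - a := by linarith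
    ring_nf
    have : 0 ≤ (b - a) ^ 3 := by positivity
    nlinarith
  refine ⟨ENNReal.ofReal_le_ofReal (by linarith), fun h => ?_⟩
  rw [ENNReal.ofReal_eq_ofReal_iff hnn2 (by linarith)] at h
  have h0 : (b - a) * (b + a) ^ 2 = 0 := by linarith
  rcases mul_eq_zero.1 h0 with h0 | h0
  · constructor
    · exact measure_mono_null Set.sdiff_subset (by rw [Real.volume_Icc]; simp [h0])
    · exact measure_mono_null Set.sdiff_subset (by rw [Real.volume_Icc]; simp [h0])
  · have h1 : b + a = 0 := by simpa using h0
    have e1 : -((b - a) / 2) = a := by linarith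
    have e2 : (b - a) / 2 = b := by linarith
    rw [e1, e2]; simp

lemma subset_of_null {A B : Set (E n)} (hA : IsCompact A) (hAc : Convex ℝ A) (hB : IsCompact B)
    (hvol : volume A ≠ 0) (h : volume (A \ B) = 0) : A ⊆ B := by
  have hne : (interior A).Nonempty := by
    by_contra hne
    rw [Set.not_nonempty_iff_eq_empty] at hne
    have h1 := hAc.addHaar_frontier volume
    rw [frontier, hne, Set.sdiff_empty, hA.isClosed.closure_eq] at h1
    exact hvol h1
  have h1 : interior A ⊆ B := by
    have ho : IsOpen (interior A \ B) := isOpen_interior.sdiff hB.isClosed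
    have h0 : volume (interior A \ B) = 0 :=
      measure_mono_null (Set.sdiff_subset_sdiff_left interior_subset) h
    rw [ho.measure_eq_zero_iff volume] at h0
    exact Set.sdiff_eq_empty.1 h0
  calc A = closure A := hA.isClosed.closure_eq.symm
    _ = closure (interior A) := (hAc.closure_interior_eq_closure_of_nonempty_interior hne).symm
    _ ⊆ B := closure_minimal h1 hB.isClosed

lemma diff_sl {A B : Set (E n)} (y : Fin n → ℝ) : sl (A \ B) y = sl A y \ sl B y := rfl

lemma M_finite {L : Set (E n)} (hL : IsCompact L) : M L ≠ ⊤ := by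
  obtain ⟨R, hR⟩ := hL.isBounded.subset_closedBall 0
  have h1 : M L ≤ ∫⁻ x in L, ENNReal.ofReal (R ^ 2) := by
    refine setLIntegral_mono' hL.measurableSet fun x hx => ENNReal.ofReal_le_ofReal ?_
    have := hR hx
    rw [mem_closedBall_zero_iff] at this
    gcongr
  refine ne_top_of_le_ne_top ?_ h1
  rw [setLIntegral_const]
  exact ENNReal.mul_ne_top (by simp) hL.measure_lt_top.ne

lemma St_eq {L : Set (E n)} (hc : IsCompact L) (hL : Convex ℝ L) (hvol : volume L ≠ 0)
    (hM : M L ≤ M (St L)) : St L = L := by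
  have hS := St_compact hc
  have hnn : ∀ y : Fin n → ℝ, 0 ≤ ∑ i, y i ^ 2 := fun y =>
    Finset.sum_nonneg (fun i _ => sq_nonneg (y i))
  have hfin := M_finite hS
  rw [M_sl hS.measurableSet] at hfin
  rw [M_sl hS.measurableSet, M_sl hc.measurableSet] at hM
  have hmeas : AEMeasurable (fun y : Fin n → ℝ =>
      ∫⁻ t in sl L y, ENNReal.ofReal (t ^ 2 + ∑ i, y i ^ 2)) volume := by
    have hme : Measurable (L.indicator (fun x => ENNReal.ofReal (‖x‖ ^ 2))) :=
      Measurable.indicator (by fun_prop) hc.measurableSet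
    have := (hme.comp (mp_mk (n := n)).measurable).lintegral_prod_right' (ν := volume)
    refine this.aemeasurable.congr (Filter.Eventually.of_forall fun y => ?_)
    have hs : MeasurableSet (sl L y) :=
      (mp_mk.measurable.comp (measurable_const.prodMk measurable_id) :
        Measurable (fun t => mk y t)) hc.measurableSet
    simp only
    rw [← lintegral_indicator hs]
    congr 1
    ext t
    by_cases ht : mk y t ∈ L
    · simp only [Function.comp]
      rw [Set.indicator_of_mem ht, Set.indicator_of_mem (show t ∈ sl L y from ht), norm_mk]
    · simp only [Function.comp]
      rw [Set.indicator_of_notMem ht, Set.indicator_of_notMem (show t ∉ sl L y from ht)]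
  have hae := ae_eq_of_ae_le_of_lintegral_le (Filter.Eventually.of_forall fun y => by
    obtain ⟨a, b, h⟩ := sl_Icc hc hL y
    rw [sl_St h, h]
    exact (slice_ineq (hnn y)).1) hfin hmeas hM
  have hae2 : ∀ᵐ y : Fin n → ℝ, volume (sl L y \ sl (St L) y) = 0 ∧
      volume (sl (St L) y \ sl L y) = 0 := by
    filter_upwards [hae] with y hy
    obtain ⟨a, b, h⟩ := sl_Icc hc hL y
    rw [sl_St h, h] at hy ⊢
    exact (slice_ineq (hnn y)).2 hy
  apply Set.Subset.antisymm
  · refine subset_of_null hS (St_convex hL) hc (by rwa [St_vol hc hL]) ?_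
    rw [vol_sl (hS.measurableSet.diff hc.measurableSet)]
    rw [lintegral_congr_ae (g := fun _ => 0), lintegral_zero]
    filter_upwards [hae2] with y hy using hy.2
  · refine subset_of_null hc hL hS hvol ?_
    rw [vol_sl (hc.measurableSet.diff hS.measurableSet)]
    rw [lintegral_congr_ae (g := fun _ => 0), lintegral_zero]
    filter_upwards [hae2] with y hy using hy.1

end RRI
namespace RRI

open Filter Topology TopologicalSpace

variable {n : ℕ}

section limits

variable {u : ℕ → NonemptyCompacts (E n)} {L : NonemptyCompacts (E n)}

lemma ev_close (h : Tendsto u atTop (𝓝 L)) {ε : ℝ} (hε : 0 < ε) :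
    ∀ᶠ k in atTop, (∀ p ∈ (L : Set (E n)), ∃ q ∈ (u k : Set (E n)), dist p q < ε) ∧
      (∀ q ∈ (u k : Set (E n)), ∃ p ∈ (L : Set (E n)), dist q p < ε) := by
  filter_upwards [Metric.tendsto_nhds.1 h ε hε] with k hk
  rw [Metric.NonemptyCompacts.dist_eq] at hk
  have hfin : Metric.hausdorffEDist (u k : Set (E n)) L ≠ ⊤ := edist_ne_top (u k) L
  refine ⟨fun p hp => ?_, fun q hq => ?_⟩
  · obtain ⟨q, hq, h⟩ := Metric.exists_dist_lt_of_hausdorffDist_lt' hp hk hfin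
    exact ⟨q, hq, by rwa [dist_comm]⟩
  · exact Metric.exists_dist_lt_of_hausdorffDist_lt hq hk hfin

lemma ev_notMem (h : Tendsto u atTop (𝓝 L)) {x : E n} (hx : x ∉ (L : Set (E n))) :
    ∀ᶠ k in atTop, x ∉ (u k : Set (E n)) := by
  obtain ⟨ε, hε, hb⟩ := Metric.isOpen_iff.1 L.isCompact.isClosed.isOpen_compl x hx
  filter_upwards [ev_close h hε] with k hk hxk
  obtain ⟨p, hp, hd⟩ := hk.2 x hxk
  exact hb (by rwa [Metric.mem_ball, dist_comm]) hp

lemma ev_mem (h : Tendsto u atTop (𝓝 L)) (hc : ∀ k, Convex ℝ (u k : Set (E n))) {x : E n}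
    (hx : x ∈ interior (L : Set (E n))) : ∀ᶠ k in atTop, x ∈ (u k : Set (E n)) := by
  obtain ⟨ε, hε, hb⟩ := Metric.nhds_basis_closedBall.mem_iff.1 (mem_interior_iff_mem_nhds.1 hx)
  filter_upwards [ev_close h hε] with k hk
  obtain ⟨p, hp, hpx⟩ := exists_norm_eq_iInf_of_complete_convex (u k).nonempty
    (u k).isCompact.isComplete (hc k) x
  rw [norm_eq_iInf_iff_real_inner_le_zero (hc k) hp] at hpx
  by_cases hxp : x = p
  · rwa [hxp]
  exfalso
  have hpos : 0 < ‖x - p‖ := norm_pos_iff.2 (sub_ne_zero.2 hxp)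
  set v := x + (ε / ‖x - p‖) • (x - p) with hv
  have hvL : v ∈ (L : Set (E n)) := by
    apply hb
    rw [mem_closedBall_iff_norm, hv, add_sub_cancel_left, norm_smul, Real.norm_of_nonneg (by positivity)]
    field_simp
    exact le_rfl
  obtain ⟨w, hw, hd⟩ := hk.1 v hvL
  rw [dist_eq_norm] at hd
  have h1 := hpx w hw
  have h2 : inner ℝ (x - p) (v - w) = ‖x - p‖ ^ 2 + ε * ‖x - p‖ - inner ℝ (x - p) (w - p) := by
    have : v - w = (x - p) + (ε / ‖x - p‖) • (x - p) - (w - p) := by rw [hv]; abel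
    rw [this, inner_sub_right, inner_add_right, real_inner_smul_right, real_inner_self_eq_norm_sq]
    field_simp
  have h3 := real_inner_le_norm (x - p) (v - w)
  nlinarith

lemma lim_convex (h : Tendsto u atTop (𝓝 L)) (hc : ∀ k, Convex ℝ (u k : Set (E n))) :
    Convex ℝ (L : Set (E n)) := by
  intro p hp q hq a b ha hb hab
  rw [← L.isCompact.isClosed.closure_eq]
  refine Metric.mem_closure_iff.2 fun ε hε => ?_
  obtain ⟨k, hk⟩ := (ev_close h (half_pos hε)).exists
  obtain ⟨p', hp', hpd⟩ := hk.1 p hp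
  obtain ⟨q', hq', hqd⟩ := hk.1 q hq
  obtain ⟨z, hz, hzd⟩ := hk.2 _ (hc k hp' hq' ha hb hab)
  refine ⟨z, hz, ?_⟩
  have h1 : dist (a • p + b • q) (a • p' + b • q') ≤ a * dist p p' + b * dist q q' := by
    refine (dist_add_add_le _ _ _ _).trans ?_
    rw [dist_smul₀, dist_smul₀, Real.norm_of_nonneg ha, Real.norm_of_nonneg hb]
  have h2 := dist_triangle (a • p + b • q) (a • p' + b • q') z
  have h3 : a * dist p p' ≤ a * (ε / 2) := by gcongr
  have h4 : b * dist q q' ≤ b * (ε / 2) := by gcongr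
  have h5 : a * (ε / 2) + b * (ε / 2) = ε / 2 := by rw [← add_mul, hab, one_mul]
  linarith

lemma lim_symm (h : Tendsto u atTop (𝓝 L)) (hc : ∀ k, ∀ x ∈ (u k : Set (E n)), -x ∈ (u k : Set (E n))) :
    ∀ x ∈ (L : Set (E n)), -x ∈ (L : Set (E n)) := by
  intro p hp
  rw [← L.isCompact.isClosed.closure_eq]
  refine Metric.mem_closure_iff.2 fun ε hε => ?_
  obtain ⟨k, hk⟩ := (ev_close h (half_pos hε)).exists
  obtain ⟨p', hp', hpd⟩ := hk.1 p hp
  obtain ⟨z, hz, hzd⟩ := hk.2 _ (hc k _ hp')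
  refine ⟨z, hz, ?_⟩
  have h2 := dist_triangle (-p) (-p') z
  rw [dist_neg_neg] at h2
  linarith

lemma usc {α : Type*} [MeasurableSpace α] (μ : Measure α) (A : ℕ → Set α) (A' D : Set α)
    (hA : ∀ k, MeasurableSet (A k)) (hA' : MeasurableSet A') (hD : MeasurableSet D)
    (hfin : μ D ≠ ⊤) (hAD : ∀ k, A k ⊆ D) (hev : ∀ x, x ∉ A' → ∀ᶠ k in atTop, x ∉ A k)
    (c : ENNReal) (hc : ∀ k, c ≤ μ (A k)) : c ≤ μ A' := by
  have h1 := limsup_lintegral_le (μ := μ) (f := fun k => (A k).indicator 1) (D.indicator 1)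
    (fun k => measurable_one.indicator (hA k))
    (fun k => Eventually.of_forall fun x =>
      Set.indicator_le_indicator_of_subset (hAD k) (fun _ => zero_le) x)
    (by rwa [lintegral_indicator_one hD])
  calc c ≤ limsup (fun k => ∫⁻ x, (A k).indicator 1 x ∂μ) atTop := by
        refine le_limsup_of_frequently_le' (Frequently.of_forall fun k => ?_)
        rw [lintegral_indicator_one (hA k)]; exact hc k
    _ ≤ _ := h1
    _ ≤ ∫⁻ x, A'.indicator 1 x ∂μ := by
        refine lintegral_mono fun x => ?_
        by_cases hx : x ∈ A'
        · rw [Set.indicator_of_mem hx]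
          refine limsup_le_of_le (h := Eventually.of_forall fun k => ?_)
          exact Set.indicator_le_self' (fun _ _ => zero_le) x
        · rw [Set.indicator_of_notMem hx]
          refine limsup_le_of_le (h := ?_)
          filter_upwards [hev x hx] with k hk
          rw [Set.indicator_of_notMem hk]
    _ = μ A' := lintegral_indicator_one hA'

lemma lsc (h : Tendsto u atTop (𝓝 L)) (hc : ∀ k, Convex ℝ (u k : Set (E n)))
    (f : E n → ENNReal) (hf : Measurable f) :
    ∫⁻ x in (L : Set (E n)), f x ≤ liminf (fun k => ∫⁻ x in (u k : Set (E n)), f x) atTop := by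
  have hL := lim_convex h hc
  have hae : (interior (L : Set (E n)) : Set (E n)) =ᵐ[volume] (L : Set (E n)) :=
    interior_ae_eq_of_null_frontier (hL.addHaar_frontier volume)
  rw [← setLIntegral_congr hae, ← lintegral_indicator isOpen_interior.measurableSet]
  simp_rw [← lintegral_indicator (NonemptyCompacts.isCompact _).measurableSet]
  refine le_trans ?_ (lintegral_liminf_le fun k => hf.indicator (u k).isCompact.measurableSet)
  refine lintegral_mono fun x => ?_
  by_cases hx : x ∈ interior (L : Set (E n))
  · rw [Set.indicator_of_mem hx]
    refine le_liminf_of_le (h := ?_)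
    filter_upwards [ev_mem h hc hx] with k hk
    rw [Set.indicator_of_mem hk]
  · rw [Set.indicator_of_notMem hx]; exact zero_le

end limits

/-- The class of competitors. -/
structure Good (r R : ℝ) (c : ENNReal) (L : Set (E n)) : Prop where
  cpt : IsCompact L
  conv : Convex ℝ L
  symm : ∀ x ∈ L, -x ∈ L
  vol : volume L = 1
  ball : L ⊆ Metric.closedBall 0 R
  W : c ≤ volume (W r L)

lemma Good.nonempty {r R : ℝ} {c : ENNReal} {L : Set (E n)} (h : Good r R c L) : L.Nonempty := by
  by_contra hne
  rw [Set.not_nonempty_iff_eq_empty] at hne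
  have := h.vol
  simp [hne] at this

lemma exists_min {r R : ℝ} (hr : 0 < r) {c : ENNReal} {K : Set (E n)} (hK : Good r R c K) :
    ∃ L : Set (E n), Good r R c L ∧ ∀ L' : Set (E n), Good r R c L' → M L ≤ M L' := by
  set C : Set (NonemptyCompacts (E n)) := {L | Good r R c (L : Set (E n))} with hC
  have hmem : ∀ {L : Set (E n)}, Good r R c L → ∃ L₀ ∈ C, (L₀ : Set (E n)) = L := fun {L} h =>
    ⟨⟨⟨L, h.cpt⟩, h.nonempty⟩, h, rfl⟩
  obtain ⟨K₀, hK₀, -⟩ := hmem hK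
  obtain ⟨v, -, hv, hvm⟩ := exists_seq_tendsto_sInf 
    (S := Set.image (fun L : NonemptyCompacts (E n) => M (L : Set (E n))) C)
    ⟨_, K₀, hK₀, rfl⟩ (OrderBot.bddBelow _)
  choose u huC huM using hvm
  obtain ⟨L, hLb, φ, hφ, hlim⟩ := (NonemptyCompacts.isCompact_subsets_of_isCompact
    (isCompact_closedBall (0 : E n) R)).tendsto_subseq (x := u) (fun k => (huC k).ball)
  have hc : ∀ k, Convex ℝ ((u ∘ φ) k : Set (E n)) := fun k => (huC _).conv
  have hLM : ∀ L' : Set (E n), Good r R c L' → M (L : Set (E n)) ≤ M L' := by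
    intro L' hL'
    obtain ⟨L₀, hL₀, rfl⟩ := hmem hL'
    have h1 := lsc hlim hc (fun x => ENNReal.ofReal (‖x‖ ^ 2)) (by fun_prop)
    have h2 : Tendsto (fun k => M ((u ∘ φ) k : Set (E n))) atTop
        (𝓝 (sInf (Set.image (fun L : NonemptyCompacts (E n) => M (L : Set (E n))) C))) := by
      have := hv.comp hφ.tendsto_atTop
      refine this.congr fun k => ?_
      simp [← huM]
    refine h1.trans ?_
    have h3 := h2.liminf_eq
    unfold M at h3
    rw [h3]
    exact sInf_le ⟨L₀, hL₀, rfl⟩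
  refine ⟨L, ⟨L.isCompact, lim_convex hlim hc, lim_symm hlim fun k => (huC _).symm, ?_, hLb, ?_⟩, hLM⟩
  · apply le_antisymm
    · have := lsc hlim hc (fun _ => 1) measurable_const
      simp only [setLIntegral_one] at this
      refine this.trans ?_
      have e : ∀ k, volume ((u ∘ φ) k : Set (E n)) = 1 := fun k => (huC _).vol
      simp only [e]; simp
    · exact usc volume (fun k => ((u ∘ φ) k : Set (E n))) L (Metric.closedBall 0 R)
        (fun k => NonemptyCompacts.isCompact _ |>.measurableSet) L.isCompact.measurableSet
        measurableSet_closedBall (isCompact_closedBall _ _).measure_lt_top.ne (fun k => (huC _).ball)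
        (fun x hx => ev_notMem hlim hx) 1 (fun k => (huC _).vol.ge)
  · refine usc volume (fun k => W r ((u ∘ φ) k : Set (E n))) (W r L)
      (Metric.closedBall 0 R ×ˢ Metric.closedBall 0 R)
      (fun k => (W_closed (NonemptyCompacts.isCompact _)).measurableSet)
      (W_closed L.isCompact).measurableSet
      (measurableSet_closedBall.prod measurableSet_closedBall)
      ((isCompact_closedBall _ _).prod (isCompact_closedBall _ _)).measure_lt_top.ne
      (fun k p hp => ⟨(huC _).ball hp.1, (huC _).ball hp.2.1⟩) ?_ c (fun k => (huC _).W)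
    intro p hp
    have hp' : p.1 ∉ (L : Set (E n)) ∨ p.2 ∉ (L : Set (E n)) ∨ r⁻¹ • (p.1 + p.2) ∉ (L : Set (E n)) := by
      by_contra hcon
      push Not at hcon
      exact hp ⟨hcon.1, hcon.2.1, (Set.mem_smul_set_iff_inv_smul_mem₀ hr.ne' _ _).2 hcon.2.2⟩
    rcases hp' with h | h | h
    · filter_upwards [ev_notMem hlim h] with k hk hh using hk hh.1
    · filter_upwards [ev_notMem hlim h] with k hk hh using hk hh.2.1
    · filter_upwards [ev_notMem hlim h] with k hk hh
      exact hk ((Set.mem_smul_set_iff_inv_smul_mem₀ hr.ne' _ _).1 hh.2.2)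

lemma good_St {r R : ℝ} (hr : 0 < r) {c : ENNReal} {L : Set (E n)} (h : Good r R c L) :
    Good r R c (St L) :=
  ⟨St_compact h.cpt, St_convex h.conv, St_symm h.symm, (St_vol h.cpt h.conv).trans h.vol,
    St_ball h.ball, h.W.trans (St_W hr h.cpt h.conv)⟩

lemma good_iso {r R : ℝ} (hr : 0 < r) {c : ENNReal} {L : Set (E n)} (h : Good r R c L)
    (g : E n ≃ₗᵢ[ℝ] E n) : Good r R c (g ⁻¹' L) := by
  have hm : MeasurePreserving g volume volume := g.measurePreserving
  refine ⟨g.toHomeomorph.isCompact_preimage.2 h.cpt,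
    h.conv.linear_preimage g.toLinearEquiv.toLinearMap, ?_, ?_, ?_, ?_⟩
  · intro x hx
    simp only [Set.mem_preimage, map_neg] at *
    exact h.symm _ hx
  · rw [hm.measure_preimage h.cpt.measurableSet.nullMeasurableSet, h.vol]
  · intro x hx
    have := h.ball hx
    simpa using this
  · refine h.W.trans (le_of_eq ?_)
    have he : RRI.W r (g ⁻¹' L) = Prod.map g g ⁻¹' (RRI.W r L) := by
      ext p
      simp [RRI.W, Set.mem_smul_set_iff_inv_smul_mem₀ hr.ne']
    rw [he, Measure.volume_eq_prod, (hm.prod hm).measure_preimage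
      (W_closed h.cpt).measurableSet.nullMeasurableSet]

lemma M_iso {L : Set (E n)} (h : IsCompact L) (g : E n ≃ₗᵢ[ℝ] E n) : M (g ⁻¹' L) = M L := by
  have hm : MeasurePreserving g volume volume := g.measurePreserving
  unfold M
  rw [← hm.setLIntegral_comp_preimage h.measurableSet (by fun_prop)]
  simp

lemma rot_inv {r R : ℝ} (hr : 0 < r) {c : ENNReal} {L : Set (E n)} (h : Good r R c L)
    (hmin : ∀ L' : Set (E n), Good r R c L' → M L ≤ M L') {z z' : E n} (hz : z ∈ L) (hzz : ‖z'‖ = ‖z‖) :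
    z' ∈ L := by
  by_cases hne : z = z'
  · rwa [← hne]
  set w := z - z' with hw
  have hw0 : 0 < ‖w‖ := norm_pos_iff.2 (sub_ne_zero.2 hne)
  set v : E n := mk 0 ‖w‖ with hv
  have hvn : ‖w‖ = ‖v‖ := by
    have : ‖v‖ ^ 2 = ‖w‖ ^ 2 := by rw [hv, norm_mk]; simp
    exact ((sq_eq_sq₀ (norm_nonneg _) (norm_nonneg _)).1 this).symm
  set g := (Submodule.span ℝ {w - v})ᗮ.reflection with hg
  have hgw : g w = v := Submodule.reflection_sub hvn
  have hgg : ∀ x, g (g x) = x := fun x => Submodule.reflection_reflection _ x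
  have hG := good_iso hr h g
  have hSt : St (g ⁻¹' L) = g ⁻¹' L := by
    refine St_eq hG.cpt hG.conv (by rw [hG.vol]; simp) ?_
    rw [M_iso h.cpt]
    exact hmin _ (good_St hr hG)
  have h1 : g z ∈ St (g ⁻¹' L) := by
    rw [hSt, Set.mem_preimage, hgg]; exact hz
  obtain ⟨y, a, b, ha, hb, he⟩ := h1
  have h2 : mk y ((b - a) / 2) ∈ St (g ⁻¹' L) := ⟨y, b, a, hb, ha, rfl⟩
  have h3 : g z' = mk y ((b - a) / 2) := by
    have e1 : g z' = g z - v := by rw [← hgw, hw, map_sub]; abel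
    have e2 : g z' = mk y ((a - b) / 2 - ‖w‖) := by
      rw [e1, he, hv, sub_eq_add_neg, neg_mk, mk_add]; congr 1; simp
    have e3 : ‖g z'‖ ^ 2 = ‖g z‖ ^ 2 := by rw [g.norm_map, g.norm_map, hzz]
    rw [e2, he, norm_mk, norm_mk] at e3
    rw [e2]
    congr 1
    have e4 : ‖w‖ * (‖w‖ - (a - b)) = 0 := by linarith
    rcases mul_eq_zero.1 e4 with e | e <;> linarith
  rw [hSt, ← h3, Set.mem_preimage, hgg] at h2
  exact h2

lemma main {r : ℝ} (hr : 0 < r) {K : Set (E n)} (hKc : IsCompact K) (hKconv : Convex ℝ K)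
    (hKsym : ∀ x ∈ K, -x ∈ K) (hKvol : volume K = 1) (rB : ℝ)
    (hBvol : volume (Metric.closedBall (0 : E n) rB) = 1) :
    volume (W r K) ≤ volume (W r (Metric.closedBall (0 : E n) rB)) := by
  obtain ⟨R, hR⟩ := hKc.isBounded.subset_closedBall 0
  obtain ⟨L, hL, hmin⟩ := exists_min hr
    (⟨hKc, hKconv, hKsym, hKvol, hR, le_rfl⟩ : Good r R (volume (W r K)) K)
  obtain ⟨z, hz, hzmax⟩ := hL.cpt.exists_isMaxOn hL.nonempty continuous_norm.continuousOn
  have hball : L = Metric.closedBall 0 ‖z‖ := by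
    apply Set.Subset.antisymm
    · intro x hx
      rw [mem_closedBall_zero_iff]
      exact hzmax hx
    · intro x hx
      rw [mem_closedBall_zero_iff] at hx
      have h0 : (0 : E n) ∈ L := by
        have := hL.conv hz (hL.symm z hz) (a := 1 / 2) (b := 1 / 2) (by norm_num) (by norm_num)
          (by norm_num)
        simpa using this
      by_cases hx0 : x = 0
      · rwa [hx0]
      have hxp : 0 < ‖x‖ := norm_pos_iff.2 hx0
      have hzp : 0 < ‖z‖ := hxp.trans_le hx
      have h1 : (‖z‖ / ‖x‖) • x ∈ L := by
        refine rot_inv hr hL hmin hz ?_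
        rw [norm_smul, Real.norm_of_nonneg (by positivity)]
        field_simp
      have h2 := hL.conv.smul_mem_of_zero_mem h0 h1 (t := ‖x‖ / ‖z‖)
        ⟨by positivity, by rw [div_le_one hzp]; exact hx⟩
      rw [smul_smul] at h2
      have : ‖x‖ / ‖z‖ * (‖z‖ / ‖x‖) = 1 := by field_simp
      rwa [this, one_smul] at h2
  have hrB : 0 ≤ rB := by
    by_contra hneg
    rw [Metric.closedBall_eq_empty.2 (not_le.1 hneg)] at hBvol
    simp at hBvol
  have hv := hL.vol
  rw [hball, ← hBvol, Measure.addHaar_closedBall _ _ hrB,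
    Measure.addHaar_closedBall _ _ (norm_nonneg z)] at hv
  have hb0 : volume (Metric.ball (0 : E n) 1) ≠ 0 := (Metric.measure_ball_pos _ _ one_pos).ne'
  have hbt : volume (Metric.ball (0 : E n) 1) ≠ ⊤ := measure_ball_lt_top.ne
  rw [ENNReal.mul_left_inj hb0 hbt, ENNReal.ofReal_eq_ofReal_iff (by positivity) (by positivity),
    pow_left_inj₀ (norm_nonneg z) hrB (by simp)] at hv
  rw [hv] at hball
  rw [← hball]
  exact hL.W

lemma prod_eq {r : ℝ} {K : Set (E n)} (hKc : IsCompact K) :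
    (volume.restrict K).prod (volume.restrict K) {p | p.1 + p.2 ∈ r • K} = volume (W r K) := by
  rw [Measure.prod_restrict, Measure.restrict_apply]
  · rw [Measure.volume_eq_prod]
    congr 1
    ext p
    simp [W]
    tauto
  · exact ((hKc.smul r).isClosed.preimage (continuous_fst.add continuous_snd)).measurableSet

end RRI

/-- For `K` compact convex symmetric of volume 1 and every `r > 0`,
`P(X_K + X'_K ∈ rK) ≤ P(X_B + X'_B ∈ rB)`, i.e. `‖X_B + X'_B‖_B` is stochastically
dominated by `‖X_K + X'_K‖_K`. Probabilities are expressed via products of the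
uniform measures, which are `volume.restrict` as the sets have volume one. -/
theorem stmt_11 (d : ℕ) (K B : Set (EuclideanSpace ℝ (Fin d)))
    (hKc : IsCompact K) (hKconv : Convex ℝ K) (hKsym : ∀ x ∈ K, -x ∈ K)
    (hKvol : volume K = 1)
    (rB : ℝ) (hB : B = Metric.closedBall 0 rB) (hBvol : volume B = 1) :
    ∀ r : ℝ, 0 < r →
      (volume.restrict K).prod (volume.restrict K) {p | p.1 + p.2 ∈ r • K}
        ≤ (volume.restrict B).prod (volume.restrict B) {p | p.1 + p.2 ∈ r • B} := by
  intro r hr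
  cases d with
  | zero =>
    have h1 : K.Nonempty := by
      by_contra hne
      rw [Set.not_nonempty_iff_eq_empty] at hne
      simp [hne] at hKvol
    have h2 : B.Nonempty := by
      by_contra hne
      rw [Set.not_nonempty_iff_eq_empty] at hne
      simp [hne] at hBvol
    rw [Subsingleton.eq_univ_of_nonempty h1, Subsingleton.eq_univ_of_nonempty h2]
  | succ n =>
    subst hB
    rw [RRI.prod_eq hKc, RRI.prod_eq (isCompact_closedBall _ _)]
    exact RRI.main hr hKc hKconv hKsym hKvol rB hBvol
end
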